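/- arXiv:2404.17919 — 3 statements merged into one kernel-verified Lean document; each statement's English description precedes it below -/
import Mathlib

section
/- Let J ⊆ {1,…,n}. If 1 ∈ J, then the colon ideal (S^{S_n}_+) : f_J is the unit ideal S. If 1 ∉ J, then g_{J,1},…,g_{J,n} is a regular sequence in S and (S^{S_n}_+) : f_J is the ideal generated by g_{J,1},…,g_{J,n}. -/
open MvPolynomial

noncomputable section

def coinvIdeal (K : Type*) [Field K] (n : ℕ) : Ideal (MvPolynomial (Fin n) K) :=
  Ideal.span {f | f.IsSymmetric ∧ constantCoeff f = 0}

def fJ (K : Type*) [Field K] (n : ℕ) (J : Finset (Fin n)) : MvPolynomial (Fin n) K :=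
  ∏ j ∈ J, (X j * ∏ i ∈ Finset.univ.filter fun i => j < i, (X j - X i))

def gJ (K : Type*) [Field K] (n : ℕ) (J : Finset (Fin n)) (i : Fin n) :
    MvPolynomial (Fin n) K :=
  if i ∈ J then
    ∏ j ∈ Finset.univ.filter fun j : Fin n => j ∉ J ∧ j < i, (X j - X i)
  else
    ∑ k ∈ Finset.univ.filter fun k : Fin n => i ≤ k,
      (∏ j ∈ Finset.univ.filter fun j : Fin n => j ∉ J ∧ j < i, (X j - X k)) * X k

open RingTheory.Sequence

/-- multiplication by `a` is injective modulo `I` -/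
def RegMod {R : Type*} [CommRing R] (I : Ideal R) (a : R) : Prop := ∀ x, a * x ∈ I → x ∈ I

lemma regMod_iff {R : Type*} [CommRing R] (I : Ideal R) (a : R) :
    IsSMulRegular (R ⧸ (I • ⊤ : Submodule R R)) a ↔ RegMod I a := by
  have hI : (I • ⊤ : Submodule R R) = I := by simp
  rw [hI]
  constructor
  · intro h x hx
    have : a • (Submodule.Quotient.mk x : R ⧸ I) = a • (Submodule.Quotient.mk 0 : R ⧸ I) := by
      rw [← Submodule.Quotient.mk_smul, ← Submodule.Quotient.mk_smul, Submodule.Quotient.eq]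
      simpa using hx
    have := h this
    rw [Submodule.Quotient.eq] at this
    simpa using this
  · intro h x y
    induction x using Submodule.Quotient.induction_on with | _ x
    induction y using Submodule.Quotient.induction_on with | _ y
    intro hxy
    simp only [← Submodule.Quotient.mk_smul] at hxy
    rw [Submodule.Quotient.eq] at hxy ⊢
    apply h
    simpa [mul_sub] using hxy

lemma wr_append_singleton {R : Type*} [CommRing R] (l : List R) (a : R) :
    IsWeaklyRegular R (l ++ [a]) ↔ IsWeaklyRegular R l ∧ RegMod (Ideal.ofList l) a := by
  rw [isWeaklyRegular_append_iff, isWeaklyRegular_singleton_iff, regMod_iff]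

lemma RegMod.of_mul_left {R : Type*} [CommRing R] {I : Ideal R} {a b : R}
    (h : RegMod I (a * b)) : RegMod I a := fun x hx => h x (by
  have := I.mul_mem_left b hx
  convert this using 1; ring)

lemma RegMod.of_mul_right {R : Type*} [CommRing R] {I : Ideal R} {a b : R}
    (h : RegMod I (a * b)) : RegMod I b := by
  rw [mul_comm] at h; exact h.of_mul_left

lemma RegMod.mul {R : Type*} [CommRing R] {I : Ideal R} {a b : R}
    (h : RegMod I a) (h' : RegMod I b) : RegMod I (a * b) := fun x hx =>
  h' _ (h _ (by rwa [← mul_assoc]))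

lemma RegMod.prod {R ι : Type*} [CommRing R] {I : Ideal R} (s : Finset ι) {a : ι → R}
    (h : ∀ i ∈ s, RegMod I (a i)) : RegMod I (∏ i ∈ s, a i) := by
  classical
  induction s using Finset.induction_on with
  | empty => intro x hx; simpa using hx
  | insert i s hi ih =>
    rw [Finset.prod_insert hi]
    exact (h i (by simp)).mul (ih fun j hj => h j (by simp [hj]))

lemma RegMod.congr {R : Type*} [CommRing R] {I : Ideal R} {a b : R}
    (h : RegMod I a) (hab : a - b ∈ I) : RegMod I b := fun x hx => h x (by
  have := I.add_mem (I.mul_mem_right x hab) hx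
  convert this using 1; ring)

lemma RegMod.of_isUnit {R : Type*} [CommRing R] {I : Ideal R} {a : R}
    (h : IsUnit a) : RegMod I a := fun _ hx => (I.unit_mul_mem_iff_mem h).1 hx

/-- homogeneous of positive degree -/
def PosHom {σ K : Type*} [CommRing K] (f : MvPolynomial σ K) : Prop :=
  ∃ d, 0 < d ∧ f.IsHomogeneous d

section
attribute [local instance] MvPolynomial.gradedAlgebra

lemma hc_mem {σ K : Type*} [CommRing K] (l : List (MvPolynomial σ K))
    (hl : ∀ f ∈ l, PosHom f) (x : MvPolynomial σ K) (hx : x ∈ Ideal.ofList l) (d : ℕ) :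
    homogeneousComponent d x ∈ Ideal.ofList l := by
  have h : (Ideal.ofList l).IsHomogeneous (homogeneousSubmodule σ K) := by
    apply Ideal.homogeneous_span
    intro f hf
    obtain ⟨d, -, hd⟩ := hl f hf
    exact ⟨d, hd⟩
  have := h d hx
  exact (MvPolynomial.decomposition.decompose'_apply x d) ▸ this

end

lemma PosHom.mem_vars {σ K : Type*} [CommRing K] {f : MvPolynomial σ K} (h : PosHom f) :
    f ∈ idealOfVars σ K := by
  obtain ⟨d, hd, h⟩ := h
  rw [← pow_one (idealOfVars σ K), mem_pow_idealOfVars_iff]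
  intro x hx
  have : x.degree = d := by
    by_contra hne
    exact (mem_support_iff.1 hx) (h.coeff_eq_zero hne)
  change _ ≤ x.degree
  omega

lemma wr_perm {σ K : Type*} [CommRing K] {l l' : List (MvPolynomial σ K)}
    (hl : ∀ f ∈ l, PosHom f) (h : IsWeaklyRegular (MvPolynomial σ K) l) (hp : l.Perm l') :
    IsWeaklyRegular (MvPolynomial σ K) l' := by
  refine h.prototype_perm hp ?_
  intro a b rs hsub T hT
  have hrs : ∀ f ∈ rs, PosHom f := fun f hf => hl f (hsub.subset (by simp [hf]))
  have ha : PosHom a := hl a (hsub.subset (by simp))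
  have key : ∀ k : ℕ, ∀ x ∈ T, ∃ z, x = a ^ k • z := by
    intro k
    have : ∀ x ∈ T, ∃ z ∈ T, x = a ^ k • z := by
      induction k with
      | zero => intro x hx; exact ⟨x, hx, by simp⟩
      | succ k ih =>
        intro x hx
        obtain ⟨z, hz, rfl⟩ := ih x hx
        rw [hT] at hz
        obtain ⟨w, hw, rfl⟩ := hz
        refine ⟨w, hw, ?_⟩
        simp [pow_succ, mul_smul]
    intro x hx
    obtain ⟨z, -, h⟩ := this x hx
    exact ⟨z, h⟩
  rw [eq_bot_iff]
  intro x hx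
  rw [Submodule.mem_bot]
  induction x using Submodule.Quotient.induction_on with | _ y
  rw [Submodule.Quotient.mk_eq_zero]
  obtain ⟨z, hz⟩ := key (y.totalDegree + 1) _ hx
  induction z using Submodule.Quotient.induction_on with | _ z
  rw [← Submodule.Quotient.mk_smul, Submodule.Quotient.eq] at hz
  have hI : (Ideal.ofList rs • ⊤ : Submodule (MvPolynomial σ K) (MvPolynomial σ K))
      = Ideal.ofList rs := by simp
  rw [hI] at hz ⊢
  rw [← sum_homogeneousComponent y]
  refine Ideal.sum_mem _ fun d hd => ?_
  have hm := hc_mem rs hrs _ hz d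
  have h0 : homogeneousComponent d (a ^ (y.totalDegree + 1) • z) = 0 := by
    apply homogeneousComponent_eq_zero'
    intro m hm
    have : a ^ (y.totalDegree + 1) • z ∈ idealOfVars σ K ^ (y.totalDegree + 1) :=
      Ideal.mul_mem_right _ _ (Ideal.pow_mem_pow ha.mem_vars _)
    rw [mem_pow_idealOfVars_iff] at this
    have := this m hm
    change _ ≤ m.degree at this
    have := Finset.mem_range.1 hd
    omega
  rw [map_sub, h0, sub_zero] at hm
  exact hm


/-- the list of the first `m` power sums -/
def PL (K : Type*) [Field K] (n m : ℕ) : List (MvPolynomial (Fin n) K) :=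
  (List.range m).map fun l => psum (Fin n) K (l + 1)

section
variable {K : Type*} [Field K] {n : ℕ}

lemma PL_succ (m : ℕ) : PL K n (m + 1) = PL K n m ++ [psum (Fin n) K (m + 1)] := by
  simp [PL, List.range_succ]

lemma psum_mem_PL {m l : ℕ} (h1 : 1 ≤ l) (h2 : l ≤ m) :
    psum (Fin n) K l ∈ Ideal.ofList (PL K n m) := by
  apply Ideal.subset_span
  simp only [PL, Set.mem_ofPred_eq, List.mem_map, List.mem_range]
  exact ⟨l - 1, by omega, by congr 1; omega⟩

lemma ofList_mono {R : Type*} [CommRing R] {l l' : List R} (h : l ⊆ l') :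
    Ideal.ofList l ≤ Ideal.ofList l' := Ideal.span_mono fun _ hx => h hx

lemma PL_mono {m m' : ℕ} (h : m ≤ m') : Ideal.ofList (PL K n m) ≤ Ideal.ofList (PL K n m') := by
  apply ofList_mono
  intro x
  simp only [PL, List.mem_map, List.mem_range]
  rintro ⟨a, h, rfl⟩
  exact ⟨a, by omega, rfl⟩

lemma sumA (A : Finset (Fin n)) (e : ℕ) :
    (∑ k, X k ^ e * ∏ i ∈ A, (X i - X k)) - (-1) ^ A.card * psum (Fin n) K (A.card + e) ∈
      Ideal.span ((fun l => psum (Fin n) K l) '' Set.Ico e (A.card + e)) := by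
  classical
  induction A using Finset.induction_on generalizing e with
  | empty => simp [psum]
  | insert a A ha ih =>
    rw [Finset.card_insert_of_notMem ha]
    have h1 := ih e
    have h2 := ih (e + 1)
    have e1 : (∑ k, X k ^ e * ∏ i ∈ insert a A, (X i - X k) : MvPolynomial (Fin n) K) =
        X a * (∑ k, X k ^ e * ∏ i ∈ A, (X i - X k)) -
        ∑ k, X k ^ (e + 1) * ∏ i ∈ A, (X i - X k) := by
      rw [Finset.mul_sum, ← Finset.sum_sub_distrib]
      refine Finset.sum_congr rfl fun k _ => ?_
      rw [Finset.prod_insert ha]; ring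
    have m1 : Ideal.span ((fun l => psum (Fin n) K l) '' Set.Ico e (A.card + e)) ≤
        Ideal.span ((fun l => psum (Fin n) K l) '' Set.Ico e (A.card + 1 + e)) :=
      Ideal.span_mono (Set.image_mono (Set.Ico_subset_Ico le_rfl (by omega)))
    have m2 : Ideal.span ((fun l => psum (Fin n) K l) '' Set.Ico (e+1) (A.card + (e+1))) ≤
        Ideal.span ((fun l => psum (Fin n) K l) '' Set.Ico e (A.card + 1 + e)) :=
      Ideal.span_mono (Set.image_mono (Set.Ico_subset_Ico (by omega) (by omega)))
    have m3 : psum (Fin n) K (A.card + e) ∈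
        Ideal.span ((fun l => psum (Fin n) K l) '' Set.Ico e (A.card + 1 + e)) :=
      Ideal.subset_span ⟨_, ⟨by omega, by omega⟩, rfl⟩
    rw [e1]
    have := Ideal.sub_mem _ (Ideal.add_mem _ (Ideal.mul_mem_left _ (X a) (m1 h1))
      (Ideal.mul_mem_left _ (X a * (-1) ^ A.card) m3)) (m2 h2)
    convert this using 1
    rw [show A.card + (e + 1) = A.card + 1 + e by ring]
    ring

lemma sumA1 (A : Finset (Fin n)) :
    (∑ k, (∏ i ∈ A, (X i - X k)) * X k) - (-1) ^ A.card * psum (Fin n) K (A.card + 1) ∈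
      Ideal.ofList (PL K n A.card) := by
  have h := sumA (K := K) A 1
  have hle : Ideal.span ((fun l => psum (Fin n) K l) '' Set.Ico 1 (A.card + 1)) ≤
      Ideal.ofList (PL K n A.card) := by
    rw [Ideal.span_le]
    rintro _ ⟨l, ⟨h1, h2⟩, rfl⟩
    exact psum_mem_PL h1 (by omega)
  have := hle h
  simp only [pow_one] at this
  rwa [Finset.sum_congr rfl fun k _ => mul_comm (X k) (∏ i ∈ A, (X i - X k))] at this

lemma sumB1 (A : Finset (Fin n)) :
    (∑ k, ∏ i ∈ A, (X i - X k)) - (n : MvPolynomial (Fin n) K) * ∏ i ∈ A, X i ∈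
      Ideal.ofList (PL K n A.card) := by
  classical
  induction A using Finset.induction_on with
  | empty => simp
  | insert a A ha ih =>
    rw [Finset.card_insert_of_notMem ha]
    have h1 := PL_mono (Nat.le_succ _) ih
    have h2 := PL_mono (Nat.le_succ _) (sumA1 (K := K) A)
    have h3 : psum (Fin n) K (A.card + 1) ∈ Ideal.ofList (PL K n (A.card + 1)) :=
      psum_mem_PL (by omega) le_rfl
    have e1 : (∑ k, ∏ i ∈ insert a A, (X i - X k) : MvPolynomial (Fin n) K) =
        X a * (∑ k, ∏ i ∈ A, (X i - X k)) - ∑ k, (∏ i ∈ A, (X i - X k)) * X k := by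
      rw [Finset.mul_sum, ← Finset.sum_sub_distrib]
      refine Finset.sum_congr rfl fun k _ => ?_
      rw [Finset.prod_insert ha]; ring
    rw [e1, Finset.prod_insert ha]
    have := Ideal.sub_mem _ (Ideal.sub_mem _ (Ideal.mul_mem_left _ (X a) h1) h2)
      (Ideal.mul_mem_left _ ((-1) ^ A.card) h3)
    convert this using 1
    ring

lemma sumB2 (A : Finset (Fin n)) (d : ℕ) (hA : A.card = d + 1) :
    (∑ k, ∏ i ∈ A, (X i - X k)) - (n : MvPolynomial (Fin n) K) * ∏ i ∈ A, X i
      - (-1) ^ (d + 1) * psum (Fin n) K (d + 1) ∈ Ideal.ofList (PL K n d) := by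
  classical
  obtain ⟨a, B, ha, rfl, hB⟩ := Finset.card_eq_succ.1 hA
  have h1 := sumB1 (K := K) B
  have h2 := sumA1 (K := K) B
  rw [hB] at h1 h2
  have e1 : (∑ k, ∏ i ∈ insert a B, (X i - X k) : MvPolynomial (Fin n) K) =
      X a * (∑ k, ∏ i ∈ B, (X i - X k)) - ∑ k, (∏ i ∈ B, (X i - X k)) * X k := by
    rw [Finset.mul_sum, ← Finset.sum_sub_distrib]
    refine Finset.sum_congr rfl fun k _ => ?_
    rw [Finset.prod_insert ha]; ring
  rw [e1, Finset.prod_insert ha]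
  have := Ideal.sub_mem _ (Ideal.mul_mem_left _ (X a) h1) h2
  convert this using 1
  ring

lemma posHom_psum (l : ℕ) : PosHom (psum (Fin n) K (l + 1)) :=
  ⟨l + 1, by omega, by
    rw [psum]
    exact IsHomogeneous.sum _ _ _ fun i _ => isHomogeneous_X_pow i (l + 1)⟩

lemma posHom_PL (m : ℕ) : ∀ f ∈ PL K n m, PosHom f := by
  intro f hf
  simp only [PL, List.mem_map] at hf
  obtain ⟨a, -, rfl⟩ := hf
  exact posHom_psum a

lemma posHom_X (i : Fin n) : PosHom (X i : MvPolynomial (Fin n) K) :=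
  ⟨1, one_pos, isHomogeneous_X _ _⟩

lemma wr_X (l : List (Fin n)) (hl : l.Nodup) :
    IsWeaklyRegular (MvPolynomial (Fin n) K) (l.map (X : Fin n → MvPolynomial (Fin n) K)) := by
  induction l using List.reverseRecOn with
  | nil => simp
  | append_singleton l i ih =>
    rw [List.nodup_append] at hl
    rw [List.map_append, List.map_singleton, wr_append_singleton]
    refine ⟨ih hl.1, ?_⟩
    have hi : i ∉ l := fun h => hl.2.2 i h i (by simp) rfl
    have e : Ideal.ofList (l.map (X : Fin n → MvPolynomial (Fin n) K)) =
        Ideal.span (X '' {j | j ∈ l}) := by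
      have : {r | r ∈ l.map (X : Fin n → MvPolynomial (Fin n) K)} = X '' {j | j ∈ l} := by
        ext f; simp
      rw [Ideal.ofList, this]
    rw [e]
    intro f hf
    rw [mem_ideal_span_X_image] at hf ⊢
    intro m hm
    obtain ⟨j, hj, hjm⟩ := hf (m + Finsupp.single i 1) (by
      rw [mem_support_iff, add_comm, coeff_X_mul]
      exact mem_support_iff.1 hm)
    refine ⟨j, hj, ?_⟩
    have : i ≠ j := by rintro rfl; exact hi hj
    simpa [Finsupp.single_apply, this] using hjm

lemma isUnit_natCast [CharZero K] (d : ℕ) (hd : d ≠ 0) :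
    IsUnit (d : MvPolynomial (Fin n) K) := by
  have : (d : MvPolynomial (Fin n) K) = C (d : K) := by simp
  rw [this]
  exact (isUnit_iff_ne_zero.2 (by exact_mod_cast hd)).map C

lemma wr_base [CharZero K] (t : ℕ) (T : Finset (Fin n)) (hT : T.card = t) :
    IsWeaklyRegular (MvPolynomial (Fin n) K) (Tᶜ.toList.map X ++ PL K n t) := by
  classical
  induction t generalizing T with
  | zero =>
    simp only [PL, List.range_zero, List.map_nil, List.append_nil]
    exact wr_X _ (Finset.nodup_toList _)
  | succ t ih =>
    have key : ∀ i ∈ T, IsWeaklyRegular (MvPolynomial (Fin n) K)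
        ((Tᶜ.toList.map X ++ PL K n t) ++ [X i]) := by
      intro i hi
      have h1 := ih (T.erase i) (by rw [Finset.card_erase_of_mem hi]; omega)
      refine wr_perm ?_ h1 ?_
      · intro f hf
        rcases List.mem_append.1 hf with hf | hf
        · obtain ⟨j, -, rfl⟩ := List.mem_map.1 hf
          exact posHom_X j
        · exact posHom_PL _ f hf
      · rw [Finset.compl_erase]
        have : (insert i Tᶜ).toList.Perm (i :: Tᶜ.toList) :=
          Finset.toList_insert (by simpa using hi)
        refine ((this.map X).append_right _).trans ?_
        rw [List.map_cons, List.cons_append]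
        exact (List.perm_append_singleton _ _).symm
    rw [PL_succ, ← List.append_assoc, wr_append_singleton]
    have hne : T.Nonempty := Finset.card_pos.1 (by omega)
    obtain ⟨i, hi⟩ := hne
    refine ⟨((wr_append_singleton _ _).1 (key i hi)).1, ?_⟩
    have hprod : RegMod (Ideal.ofList (Tᶜ.toList.map X ++ PL K n t)) (∏ i ∈ T, X i) :=
      RegMod.prod T fun i hi => ((wr_append_singleton _ _).1 (key i hi)).2
    have hX : ∀ k ∉ T, (X k : MvPolynomial (Fin n) K) ∈
        Ideal.ofList (Tᶜ.toList.map X ++ PL K n t) := by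
      intro k hk
      apply Ideal.subset_span
      simp [hk]
    set I := Ideal.ofList (Tᶜ.toList.map X ++ PL K n t) with hI
    have h2 : (∑ k, ∏ i ∈ T, (X i - X k)) - ((n - (t + 1) : ℕ) : MvPolynomial (Fin n) K) *
        ∏ i ∈ T, X i ∈ I := by
      have e1 : (∑ k, ∏ i ∈ T, (X i - X k) : MvPolynomial (Fin n) K) =
          ∑ k ∈ Tᶜ, ∏ i ∈ T, (X i - X k) := by
        symm
        apply Finset.sum_subset (Finset.subset_univ _)
        intro k _ hk
        exact Finset.prod_eq_zero (i := k) (by simpa using hk) (sub_self _)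
      have e2 : ((n - (t + 1) : ℕ) : MvPolynomial (Fin n) K) * ∏ i ∈ T, X i =
          ∑ k ∈ Tᶜ, ∏ i ∈ T, X i := by
        simp [Finset.card_compl, hT]
      rw [e1, e2, ← Finset.sum_sub_distrib]
      refine Ideal.sum_mem _ fun k hk => ?_
      rw [← Ideal.Quotient.eq_zero_iff_mem, map_sub, map_prod, map_prod]
      have : Ideal.Quotient.mk I (X k) = 0 :=
        Ideal.Quotient.eq_zero_iff_mem.2 (hX k (by simpa using hk))
      simp [this]
    have h3 := ofList_mono (List.subset_append_right (Tᶜ.toList.map X) _) (sumB2 (K := K) T t hT)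
    rw [← hI] at h3
    have hle : t + 1 ≤ n := by
      have := Finset.card_le_univ T
      simp at this; omega
    have h4 := Ideal.sub_mem _ h2 h3
    have h5 : RegMod I (((t + 1 : ℕ) : MvPolynomial (Fin n) K) * ∏ i ∈ T, X i) :=
      (RegMod.of_isUnit (isUnit_natCast _ (by omega))).mul hprod
    have h6 : RegMod I (-(-1) ^ (t + 1) * psum (Fin n) K (t + 1)) := by
      refine h5.congr ?_
      convert h4 using 1
      rw [Nat.cast_sub hle]
      ring
    exact h6.of_mul_right

lemma wr_PL [CharZero K] : IsWeaklyRegular (MvPolynomial (Fin n) K) (PL K n n) := by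
  have := wr_base (K := K) n (Finset.univ : Finset (Fin n)) (by simp)
  simpa using this

lemma esymm_mem [CharZero K] (k : ℕ) (h1 : 1 ≤ k) (h2 : k ≤ n) :
    esymm (Fin n) K k ∈ Ideal.ofList (PL K n n) := by
  have h := mul_esymm_eq_sum (Fin n) K k
  rw [← Ideal.unit_mul_mem_iff_mem _ (isUnit_natCast (K := K) (n := n) k (by omega)), h]
  refine Ideal.mul_mem_left _ _ (Ideal.sum_mem _ fun a ha => Ideal.mul_mem_left _ _ ?_)
  rw [Finset.mem_filter] at ha
  have ha1 := Finset.HasAntidiagonal.mem_antidiagonal.1 ha.1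
  have ha2 := ha.2
  exact psum_mem_PL (by omega) (by omega)

lemma coinv_eq [CharZero K] : coinvIdeal K n = Ideal.ofList (PL K n n) := by
  apply le_antisymm
  · rw [coinvIdeal, Ideal.span_le]
    rintro f ⟨hs, hc⟩
    obtain ⟨q, hq⟩ := esymmAlgHom_fin_surjective (R := K) (m := n) (n := n) le_rfl ⟨f, hs⟩
    have hq' : aeval (fun i : Fin n => esymm (Fin n) K (i + 1)) q = f := by
      rw [← esymmAlgHom_apply, hq]
    have hmem : aeval (fun i : Fin n => esymm (Fin n) K (i + 1)) q - C (constantCoeff q) ∈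
        Ideal.ofList (PL K n n) := by
      rw [← Ideal.Quotient.eq_zero_iff_mem, map_sub, sub_eq_zero, aeval_def, eval₂_eq, map_sum]
      rw [Finset.sum_eq_single 0]
      · simp [constantCoeff_eq]
      · intro d _ hd
        obtain ⟨i, hi⟩ := Finsupp.ne_iff.1 hd
        rw [map_mul, map_prod, Finset.prod_eq_zero (i := i) (by simpa using hi), mul_zero]
        rw [map_pow, Ideal.Quotient.eq_zero_iff_mem.2 (esymm_mem _ (by omega) (by omega)),
          zero_pow (by simpa using hi)]
      · intro h
        simp [notMem_support_iff.1 h]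
    have hcz : constantCoeff q = 0 := by
      have : Ideal.ofList (PL K n n) ≤ RingHom.ker (constantCoeff : MvPolynomial (Fin n) K →+* K) := by
        rw [Ideal.span_le]
        intro g hg
        obtain ⟨d, hd, hg⟩ := posHom_PL _ g hg
        rw [SetLike.mem_coe, RingHom.mem_ker, constantCoeff_eq]
        exact hg.coeff_eq_zero (by simp; omega)
      have := this hmem
      rw [RingHom.mem_ker, map_sub, hq', hc] at this
      simpa using this
    rw [hcz, hq'] at hmem
    simpa using hmem
  · rw [Ideal.span_le]
    intro g hg
    simp only [PL, Set.mem_ofPred_eq, List.mem_map, List.mem_range] at hg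
    obtain ⟨a, -, rfl⟩ := hg
    apply Ideal.subset_span
    refine ⟨psum_isSymmetric _ _ _, ?_⟩
    simp [psum]

end

section
variable {K : Type*} [Field K] {n : ℕ}

/-- power sums followed by the `g_{J,j}` with `j ∈ J` -/
def QL (K : Type*) [Field K] (n : ℕ) (J : Finset (Fin n)) : List (MvPolynomial (Fin n) K) :=
  PL K n (n - J.card) ++ J.toList.map (gJ K n J)

lemma ofList_perm {R : Type*} [CommRing R] {l l' : List R} (h : l.Perm l') :
    Ideal.ofList l = Ideal.ofList l' :=
  le_antisymm (ofList_mono h.subset) (ofList_mono h.symm.subset)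

lemma posHom_QL (hn : 0 < n) (J : Finset (Fin n)) (h0 : (⟨0, hn⟩ : Fin n) ∉ J) :
    ∀ f ∈ QL K n J, PosHom f := by
  intro f hf
  rcases List.mem_append.1 hf with hf | hf
  · exact posHom_PL _ f hf
  · obtain ⟨z, hz, rfl⟩ := List.mem_map.1 hf
    rw [Finset.mem_toList] at hz
    refine ⟨∑ j ∈ Finset.univ.filter fun j : Fin n => j ∉ J ∧ j < z, 1, ?_, ?_⟩
    · rw [← Finset.card_eq_sum_ones, Finset.card_pos]
      refine ⟨⟨0, hn⟩, ?_⟩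
      simp only [Finset.mem_filter, Finset.mem_univ, true_and]
      refine ⟨h0, ?_⟩
      have : z ≠ ⟨0, hn⟩ := by rintro rfl; exact h0 hz
      rw [Fin.lt_def]
      have : (z : ℕ) ≠ 0 := fun h => this (Fin.ext h)
      simp only; omega
    · rw [gJ, if_pos hz]
      exact IsHomogeneous.prod _ _ _ fun i _ => (isHomogeneous_X _ _).sub (isHomogeneous_X _ _)

lemma colon_step {R : Type*} [CommRing R] {I : Ideal R} {p u g c : R} (hp : RegMod I p)
    (hu : IsUnit u) (h : p - u * (g * c) ∈ I) (x : R) :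
    x * c ∈ I ⊔ Ideal.span {p} ↔ x ∈ I ⊔ Ideal.span {g} := by
  have hc : RegMod I c := (hp.congr h).of_mul_right.of_mul_right
  obtain ⟨v, hv⟩ := hu.exists_right_inv
  simp only [Submodule.mem_sup, Ideal.mem_span_singleton']
  constructor
  · rintro ⟨l, hl, _, ⟨y, rfl⟩, hx⟩
    refine ⟨x - y * u * g, ?_, _, ⟨y * u, rfl⟩, by ring⟩
    apply hc
    have := I.add_mem hl (I.mul_mem_left y h)
    convert this using 1
    linear_combination -hx
  · rintro ⟨l, hl, _, ⟨y, rfl⟩, rfl⟩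
    refine ⟨l * c - y * v * (p - u * (g * c)), I.sub_mem (I.mul_mem_right _ hl)
      (I.mul_mem_left _ h), _, ⟨y * v, rfl⟩, ?_⟩
    linear_combination (y * g * c) * hv

lemma step_congr (J : Finset (Fin n)) (j : Fin n) (hj : ∀ z ∈ J, z < j) (m : ℕ)
    (hm : J.card + m + 1 = n) :
    ∃ u : MvPolynomial (Fin n) K, IsUnit u ∧ psum (Fin n) K (m + 1) -
      u * (gJ K n (insert j J) j * (X j * ∏ i ∈ Finset.univ.filter fun i => j < i, (X j - X i)))
      ∈ Ideal.ofList (PL K n m ++ J.toList.map (gJ K n J)) := by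
  classical
  have hjJ : j ∉ J := fun h => lt_irrefl _ (hj j h)
  set A := Jᶜ.erase j with hA
  have hcard : A.card = m := by
    rw [hA, Finset.card_erase_of_mem (by simpa using hjJ), Finset.card_compl]
    simp; omega
  set I := Ideal.ofList (PL K n m ++ J.toList.map (gJ K n J)) with hI
  have h1 := sumA1 (K := K) A
  rw [hcard] at h1
  have h1' := ofList_mono (List.subset_append_left _ (J.toList.map (gJ K n J))) h1
  rw [← hI] at h1'
  have h2 : (∑ k, (∏ i ∈ A, (X i - X k)) * X k) - (∏ i ∈ A, (X i - X j)) * X j ∈ I := by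
    rw [← Finset.add_sum_erase Finset.univ _ (Finset.mem_univ j), add_sub_cancel_left]
    refine Ideal.sum_mem _ fun k hk => ?_
    have hkj : k ≠ j := Finset.ne_of_mem_erase hk
    by_cases hkJ : k ∈ J
    · apply Ideal.mul_mem_right
      have hg : gJ K n J k ∈ I := by
        apply Ideal.subset_span
        simp only [Set.mem_ofPred_eq, List.mem_append, List.mem_map, Finset.mem_toList]
        exact Or.inr ⟨k, hkJ, rfl⟩
      rw [gJ, if_pos hkJ] at hg
      refine Ideal.mem_of_dvd _ (Finset.prod_dvd_prod_of_subset _ _ _ ?_) hg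
      intro i hi
      simp only [Finset.mem_filter, Finset.mem_univ, true_and] at hi
      simp only [hA, Finset.mem_erase, Finset.mem_compl]
      exact ⟨(hi.2.trans (hj k hkJ)).ne, hi.1⟩
    · rw [Finset.prod_eq_zero (i := k) _ (sub_self _), zero_mul]
      · exact I.zero_mem
      · simp [hA, hkj, hkJ]
  set s := (Finset.univ.filter fun i : Fin n => j < i).card with hs
  have h3 : (∏ i ∈ A, (X i - X j)) * X j = (-1 : MvPolynomial (Fin n) K) ^ s *
      (gJ K n (insert j J) j * (X j * ∏ i ∈ Finset.univ.filter fun i => j < i, (X j - X i))) := by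
    have hAu : A = (Finset.univ.filter fun i : Fin n => i ∉ insert j J ∧ i < j) ∪
        (Finset.univ.filter fun i : Fin n => j < i) := by
      ext i
      simp only [hA, Finset.mem_erase, Finset.mem_compl, Finset.mem_union, Finset.mem_filter,
        Finset.mem_univ, true_and, Finset.mem_insert, not_or]
      constructor
      · rintro ⟨h, h'⟩
        rcases lt_or_gt_of_ne h with hlt | hgt
        · exact Or.inl ⟨⟨h, h'⟩, hlt⟩
        · exact Or.inr hgt
      · rintro (h | h)
        · exact h.1
        · exact ⟨h.ne', fun hi => lt_asymm h (hj i hi)⟩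
    have hd : Disjoint (Finset.univ.filter fun i : Fin n => i ∉ insert j J ∧ i < j)
        (Finset.univ.filter fun i : Fin n => j < i) := by
      rw [Finset.disjoint_left]
      intro i hi hi'
      simp only [Finset.mem_filter] at hi hi'
      exact lt_asymm hi.2.2 hi'.2
    rw [hAu, Finset.prod_union hd, gJ, if_pos (Finset.mem_insert_self _ _)]
    have : (∏ i ∈ Finset.univ.filter fun i : Fin n => j < i, (X i - X j) :
        MvPolynomial (Fin n) K) = (-1) ^ s *
        ∏ i ∈ Finset.univ.filter fun i => j < i, (X j - X i) := by
      rw [hs, ← Finset.prod_const, ← Finset.prod_mul_distrib]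
      refine Finset.prod_congr rfl fun i _ => by ring
    rw [this]; ring
  rw [h3] at h2
  refine ⟨(-1) ^ (m + s), (isUnit_one.neg).pow _, ?_⟩
  have h4 := I.mul_mem_left ((-1) ^ m) (I.sub_mem h2 h1')
  convert h4 using 1
  have hmm : ((-1 : MvPolynomial (Fin n) K) ^ m) * (-1) ^ m = 1 := by
    rw [← mul_pow]; simp
  rw [pow_add]
  linear_combination -(psum (Fin n) K (m + 1)) * hmm

lemma main_ind [CharZero K] (hn : 0 < n) (J : Finset (Fin n)) (h0 : (⟨0, hn⟩ : Fin n) ∉ J) :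
    IsWeaklyRegular (MvPolynomial (Fin n) K) (QL K n J) ∧
    ∀ x, x * fJ K n J ∈ Ideal.ofList (PL K n n) ↔ x ∈ Ideal.ofList (QL K n J) := by
  classical
  induction J using Finset.induction_on_max with
  | empty => simp [QL, fJ, wr_PL]
  | insert j J hj ih =>
    have hjJ : j ∉ J := fun h => lt_irrefl _ (hj j h)
    obtain ⟨ih1, ih2⟩ := ih (fun h => h0 (Finset.mem_insert_of_mem h))
    have hc := Finset.card_le_univ (insert j J)
    rw [Finset.card_insert_of_notMem hjJ, Fintype.card_fin] at hc
    obtain ⟨m, hm⟩ : ∃ m, J.card + m + 1 = n := ⟨n - (J.card + 1), by omega⟩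
    obtain ⟨u, hu, hcong⟩ := step_congr (K := K) J j hj m hm
    have hp1 : (QL K n J).Perm ((PL K n m ++ J.toList.map (gJ K n J)) ++
        [psum (Fin n) K (m + 1)]) := by
      rw [QL, show n - J.card = m + 1 by omega, PL_succ, List.append_assoc, List.append_assoc]
      exact List.Perm.append_left _ List.perm_append_comm
    have hgeq : ∀ z ∈ J, gJ K n (insert j J) z = gJ K n J z := by
      intro z hz
      rw [gJ, gJ, if_pos hz, if_pos (Finset.mem_insert_of_mem hz)]
      congr 1
      ext i
      simp only [Finset.mem_filter, Finset.mem_univ, true_and, Finset.mem_insert, not_or]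
      constructor
      · rintro ⟨⟨-, h⟩, h'⟩; exact ⟨h, h'⟩
      · rintro ⟨h, h'⟩; exact ⟨⟨(h'.trans (hj z hz)).ne, h⟩, h'⟩
    have hp2 : (QL K n (insert j J)).Perm ((PL K n m ++ J.toList.map (gJ K n J)) ++
        [gJ K n (insert j J) j]) := by
      rw [QL, Finset.card_insert_of_notMem hjJ, show n - (J.card + 1) = m by omega,
        List.append_assoc]
      apply List.Perm.append_left
      refine ((Finset.toList_insert hjJ).map _).trans ?_
      rw [List.map_cons, List.map_congr_left (g := gJ K n J)
        (fun z hz => hgeq z (Finset.mem_toList.1 hz))]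
      exact (List.perm_append_singleton _ _).symm
    have hw := wr_perm (posHom_QL hn J (fun h => h0 (Finset.mem_insert_of_mem h))) ih1 hp1
    rw [wr_append_singleton] at hw
    have hw2 : IsWeaklyRegular (MvPolynomial (Fin n) K)
        ((PL K n m ++ J.toList.map (gJ K n J)) ++ [gJ K n (insert j J) j]) := by
      rw [wr_append_singleton]
      exact ⟨hw.1, (hw.2.congr hcong).of_mul_right.of_mul_left⟩
    refine ⟨wr_perm ?_ hw2 hp2.symm, ?_⟩
    · intro f hf
      exact posHom_QL hn _ h0 f (hp2.symm.subset hf)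
    · intro x
      have e : x * fJ K n (insert j J) =
          (x * (X j * ∏ i ∈ Finset.univ.filter fun i => j < i, (X j - X i))) * fJ K n J := by
        rw [fJ, Finset.prod_insert hjJ, fJ]; ring
      rw [e, ih2, ofList_perm hp1, ofList_perm hp2, Ideal.ofList_append _ [_],
        Ideal.ofList_append _ [_], Ideal.ofList_singleton, Ideal.ofList_singleton]
      exact colon_step hw.2 hu hcong x

lemma wr_transfer {R : Type*} [CommRing R] (n : ℕ) (g h : Fin n → R)
    (H : ∀ i, ∃ u, IsUnit u ∧ h i - u * g i ∈ Ideal.span (h '' {k | k < i}))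
    (hw : IsWeaklyRegular R (List.ofFn h)) :
    IsWeaklyRegular R (List.ofFn g) ∧ Ideal.ofList (List.ofFn g) = Ideal.ofList (List.ofFn h) := by
  induction n with
  | zero => simp
  | succ n ih =>
    rw [List.ofFn_succ_last, wr_append_singleton] at hw
    have ih' := ih (fun i => g i.castSucc) (fun i => h i.castSucc) (by
      intro i
      obtain ⟨u, hu, hh⟩ := H i.castSucc
      refine ⟨u, hu, Ideal.span_mono ?_ hh⟩
      rintro _ ⟨k, hk, rfl⟩
      have hk' : (k : ℕ) < i := hk
      exact ⟨⟨k, by omega⟩, hk', rfl⟩) hw.1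
    obtain ⟨u, hu, hh⟩ := H (Fin.last n)
    have hh' : h (Fin.last n) - u * g (Fin.last n) ∈
        Ideal.ofList (List.ofFn fun i : Fin n => h i.castSucc) := by
      refine Ideal.span_mono ?_ hh
      rintro _ ⟨k, hk, rfl⟩
      have hk' : (k : ℕ) < n := hk
      simp only [Set.mem_ofPred_eq, List.mem_ofFn]
      exact ⟨⟨k, hk'⟩, rfl⟩
    rw [List.ofFn_succ_last, wr_append_singleton, ih'.2, List.ofFn_succ_last]
    refine ⟨⟨ih'.1, (hw.2.congr hh').of_mul_right⟩, ?_⟩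
    rw [Ideal.ofList_append, Ideal.ofList_append, ih'.2, Ideal.ofList_singleton,
      Ideal.ofList_singleton]
    obtain ⟨v, hv⟩ := hu.exists_right_inv
    apply le_antisymm
    · refine sup_le le_sup_left ?_
      rw [Ideal.span_singleton_le_iff_mem, Submodule.mem_sup]
      refine ⟨-v * (h (Fin.last n) - u * g (Fin.last n)), Ideal.mul_mem_left _ _ hh',
        v * h (Fin.last n), Ideal.mem_span_singleton'.2 ⟨_, rfl⟩, ?_⟩
      linear_combination g (Fin.last n) * hv
    · refine sup_le le_sup_left ?_
      rw [Ideal.span_singleton_le_iff_mem, Submodule.mem_sup]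
      exact ⟨_, hh', u * g (Fin.last n), Ideal.mem_span_singleton'.2 ⟨_, rfl⟩, by ring⟩

/-- number of indices outside `J` below `i` -/
def cJ (J : Finset (Fin n)) (i : Fin n) : ℕ :=
  (Finset.univ.filter fun j : Fin n => j ∉ J ∧ j < i).card

lemma cJ_injOn (J : Finset (Fin n)) (D : Finset (Fin n)) (hD : ∀ k ∈ D, k ∉ J) :
    Set.InjOn (cJ J) D := by
  have key : ∀ a ∈ D, ∀ b, a < b → cJ J a < cJ J b := by
    intro a ha b hab
    apply Finset.card_lt_card
    rw [Finset.ssubset_iff_of_subset]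
    · exact ⟨a, by simp [hD a ha, hab], by simp⟩
    · intro i
      simp only [Finset.mem_filter, Finset.mem_univ, true_and]
      rintro ⟨h, h'⟩; exact ⟨h, h'.trans hab⟩
  intro a ha b hb hab
  rcases lt_trichotomy a b with h | h | h
  · exact absurd hab (key a ha b h).ne
  · exact h
  · exact absurd hab (key b hb a h).ne'

lemma cJ_image (J : Finset (Fin n)) (D : Finset (Fin n)) (hD : ∀ k ∈ D, k ∉ J)
    (hD' : ∀ k ∈ D, ∀ j ∉ J, j < k → j ∈ D) :
    D.image (cJ J) = Finset.range D.card := by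
  classical
  apply Finset.eq_of_subset_of_card_le
  · intro l hl
    obtain ⟨k, hk, rfl⟩ := Finset.mem_image.1 hl
    rw [Finset.mem_range]
    apply Finset.card_lt_card
    rw [Finset.ssubset_iff_of_subset]
    · exact ⟨k, hk, by simp⟩
    · intro i
      simp only [Finset.mem_filter, Finset.mem_univ, true_and]
      rintro ⟨h, h'⟩; exact hD' k hk i h h'
  · rw [Finset.card_image_of_injOn (cJ_injOn J D hD), Finset.card_range]

/-- the sequence interleaving the power sums and the `g_{J,j}` with `j ∈ J` -/
def hJ (K : Type*) [Field K] (n : ℕ) (J : Finset (Fin n)) (i : Fin n) :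
    MvPolynomial (Fin n) K :=
  if i ∈ J then gJ K n J i else psum (Fin n) K (cJ J i + 1)

lemma hJ_perm (J : Finset (Fin n)) : (QL K n J).Perm (List.ofFn (hJ K n J)) := by
  classical
  rw [← Multiset.coe_eq_coe]
  have e1 : (↑(List.ofFn (hJ K n J)) : Multiset (MvPolynomial (Fin n) K)) =
      (Finset.univ : Finset (Fin n)).val.map (hJ K n J) := by
    rw [List.ofFn_eq_map]; rfl
  have e2 : (Finset.univ : Finset (Fin n)).val = Jᶜ.val + J.val := by
    have : (Finset.univ : Finset (Fin n)) = Jᶜ.disjUnion J disjoint_compl_left := by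
      ext i
      simp only [Finset.mem_univ, Finset.mem_disjUnion, Finset.mem_compl, true_iff]
      tauto
    rw [this, Finset.disjUnion_val]
  have e3 : Jᶜ.val.map (cJ J) = (Finset.range (n - J.card)).val := by
    rw [← Finset.image_val_of_injOn (cJ_injOn J Jᶜ (fun k hk => Finset.mem_compl.1 hk)),
      cJ_image J Jᶜ (fun k hk => Finset.mem_compl.1 hk) (by intro k _ j hj _; simpa using hj), Finset.card_compl,
      Fintype.card_fin]
  rw [e1, e2, Multiset.map_add, QL, ← Multiset.coe_add]
  congr 1
  · have : Jᶜ.val.map (hJ K n J) = (Jᶜ.val.map (cJ J)).map fun l => psum (Fin n) K (l + 1) := by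
      rw [Multiset.map_map]
      refine Multiset.map_congr rfl fun i hi => ?_
      have : i ∉ J := by simpa using hi
      simp [hJ, this]
    rw [this, e3]
    rfl
  · rw [← Multiset.map_coe, Finset.coe_toList]
    refine Multiset.map_congr rfl fun i hi => ?_
    have : i ∈ J := by simpa using hi
    simp [hJ, this]

lemma hJ_congr (J : Finset (Fin n)) (i : Fin n) : ∃ u : MvPolynomial (Fin n) K, IsUnit u ∧
    hJ K n J i - u * gJ K n J i ∈ Ideal.span (hJ K n J '' {k | k < i}) := by
  classical
  by_cases hi : i ∈ J
  · exact ⟨1, isUnit_one, by simp [hJ, hi]⟩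
  set I := Ideal.span (hJ K n J '' {k | k < i}) with hI
  set D := Finset.univ.filter fun j : Fin n => j ∉ J ∧ j < i with hD
  have hDc : cJ J i = D.card := rfl
  have h1 := sumA1 (K := K) D
  have hPL : Ideal.ofList (PL K n D.card) ≤ I := by
    rw [Ideal.span_le]
    intro f hf
    simp only [PL, Set.mem_ofPred_eq, List.mem_map, List.mem_range] at hf
    obtain ⟨l, hl, rfl⟩ := hf
    have him := cJ_image J D (fun k hk => (Finset.mem_filter.1 hk).2.1) (by
      intro k hk j hj hjk
      simp only [hD, Finset.mem_filter, Finset.mem_univ, true_and] at hk ⊢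
      exact ⟨hj, hjk.trans hk.2⟩)
    rw [← Finset.mem_range, ← him] at hl
    obtain ⟨k, hk, rfl⟩ := Finset.mem_image.1 hl
    simp only [hD, Finset.mem_filter, Finset.mem_univ, true_and] at hk
    apply Ideal.subset_span
    exact ⟨k, hk.2, by simp [hJ, hk.1]⟩
  have h2 : (∑ k, (∏ j ∈ D, (X j - X k)) * X k) - gJ K n J i ∈ I := by
    rw [gJ, if_neg hi, ← Finset.sum_filter_add_sum_filter_not Finset.univ (fun k => i ≤ k),
      ← hD, add_sub_cancel_left]
    refine Ideal.sum_mem _ fun k hk => ?_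
    simp only [Finset.mem_filter, Finset.mem_univ, true_and, not_le] at hk
    by_cases hkJ : k ∈ J
    · apply Ideal.mul_mem_right
      have hg : hJ K n J k ∈ I := Ideal.subset_span ⟨k, hk, rfl⟩
      rw [hJ, if_pos hkJ, gJ, if_pos hkJ] at hg
      refine Ideal.mem_of_dvd _ (Finset.prod_dvd_prod_of_subset _ _ _ ?_) hg
      intro j
      simp only [hD, Finset.mem_filter, Finset.mem_univ, true_and]
      rintro ⟨h, h'⟩; exact ⟨h, h'.trans hk⟩
    · rw [Finset.prod_eq_zero (i := k) _ (sub_self _), zero_mul]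
      · exact I.zero_mem
      · simp [hD, hk, hkJ]
  refine ⟨(-1) ^ D.card, (isUnit_one.neg).pow _, ?_⟩
  have h4 := I.mul_mem_left ((-1) ^ D.card) (I.sub_mem h2 (hPL h1))
  convert h4 using 1
  have hmm : ((-1 : MvPolynomial (Fin n) K) ^ D.card) * (-1) ^ D.card = 1 := by
    rw [← mul_pow]; simp
  rw [hJ, if_neg hi, hDc]
  linear_combination -(psum (Fin n) K (D.card + 1)) * hmm

lemma f_zero_mem (hn : 0 < n) (J : Finset (Fin n)) (h0 : (⟨0, hn⟩ : Fin n) ∈ J) :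
    fJ K n J ∈ Ideal.ofList (PL K n n) := by
  classical
  set z : Fin n := ⟨0, hn⟩ with hz
  refine Ideal.mem_of_dvd _ (Finset.dvd_prod_of_mem _ h0) ?_
  set A := (Finset.univ.erase z : Finset (Fin n)) with hA
  have hcard : A.card + 1 = n := by
    rw [hA, Finset.card_erase_of_mem (Finset.mem_univ _)]; simp; omega
  have h1 := PL_mono (m' := n) (by omega) (sumA1 (K := K) A)
  have h2 : psum (Fin n) K (A.card + 1) ∈ Ideal.ofList (PL K n n) :=
    psum_mem_PL (by omega) (by omega)
  have h3 : (∑ k, (∏ i ∈ A, (X i - X k)) * X k : MvPolynomial (Fin n) K) =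
      (∏ i ∈ A, (X i - X z)) * X z := by
    apply Finset.sum_eq_single z
    · intro k _ hk
      rw [Finset.prod_eq_zero (i := k) _ (sub_self _), zero_mul]
      simp [hA, hk]
    · simp
  have hAf : A = Finset.univ.filter fun i => z < i := by
    ext i
    simp only [hA, Finset.mem_erase, Finset.mem_univ, and_true, Finset.mem_filter, true_and,
      hz, Fin.lt_def, ne_eq, Fin.ext_iff]
    omega
  rw [h3] at h1
  have h4 := Ideal.add_mem _ h1 (Ideal.mul_mem_left _ ((-1) ^ A.card) h2)
  rw [sub_add_cancel] at h4
  have h5 : X z * ∏ i ∈ Finset.univ.filter (fun i => z < i), (X z - X i) =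
      (-1 : MvPolynomial (Fin n) K) ^ A.card * ((∏ i ∈ A, (X i - X z)) * X z) := by
    rw [← hAf]
    have : (∏ i ∈ A, (X z - X i) : MvPolynomial (Fin n) K) = (-1) ^ A.card *
        ∏ i ∈ A, (X i - X z) := by
      rw [← Finset.prod_const, ← Finset.prod_mul_distrib]
      refine Finset.prod_congr rfl fun i _ => by ring
    rw [this]; ring
  rw [h5]
  exact Ideal.mul_mem_left _ _ h4

lemma ofList_ne_top (l : List (MvPolynomial (Fin n) K)) (hl : ∀ f ∈ l, PosHom f) :
    Ideal.ofList l ≠ ⊤ := by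
  intro h
  have : Ideal.ofList l ≤ RingHom.ker (constantCoeff : MvPolynomial (Fin n) K →+* K) := by
    rw [Ideal.span_le]
    intro g hg
    obtain ⟨d, hd, hg⟩ := hl g hg
    rw [SetLike.mem_coe, RingHom.mem_ker, constantCoeff_eq]
    exact hg.coeff_eq_zero (by simp; omega)
  rw [h] at this
  have := this (Submodule.mem_top (x := 1))
  simp [RingHom.mem_ker] at this

end

theorem statement2 (K : Type*) [Field K] [CharZero K] (n : ℕ) (hn : 0 < n)
    (J : Finset (Fin n)) :
    ((⟨0, hn⟩ : Fin n) ∈ J →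
      (coinvIdeal K n).colon (Ideal.span {fJ K n J}) = ⊤) ∧
    ((⟨0, hn⟩ : Fin n) ∉ J →
      RingTheory.Sequence.IsRegular (MvPolynomial (Fin n) K) (List.ofFn (gJ K n J)) ∧
      (coinvIdeal K n).colon (Ideal.span {fJ K n J}) =
        Ideal.span (Set.range (gJ K n J))) := by
  constructor
  · intro h0
    rw [Submodule.colon_eq_top_iff_subset, coinv_eq]
    exact (Ideal.span_singleton_le_iff_mem _).2 (f_zero_mem hn J h0)
  · intro h0
    obtain ⟨hw, hcol⟩ := main_ind (K := K) hn J h0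
    have hp := hJ_perm (K := K) J
    obtain ⟨hw', he⟩ := wr_transfer n (gJ K n J) (hJ K n J) (hJ_congr J)
      (wr_perm (posHom_QL hn J h0) hw hp)
    rw [← ofList_perm hp] at he
    refine ⟨⟨hw', ?_⟩, ?_⟩
    · rw [he, smul_eq_mul, Ideal.mul_top]
      exact (ofList_ne_top _ (posHom_QL hn J h0)).symm
    · have hr : Ideal.span (Set.range (gJ K n J)) = Ideal.ofList (List.ofFn (gJ K n J)) := by
        have : {r | r ∈ List.ofFn (gJ K n J)} = Set.range (gJ K n J) := by
          ext f; simp [List.mem_ofFn]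
        rw [Ideal.ofList, this]
      rw [hr, he, coinv_eq]
      ext x
      rw [Ideal.mem_colon_span_singleton, hcol]
end
end

section
/- For every subset T ⊆ Φ̃⁺, the product ∏_{α∈T} α lies in the coinvariant ideal (S^{S_n}_+) if and only if the complement Φ̃⁺ ∖ T does not span the K-vector space of linear forms K·{x_1,…,x_n}. -/
open MvPolynomial

noncomputable section

/-- The set of linear forms `Φ̃⁺ = {x_i − x_j : i < j} ∪ {x_1, …, x_n}`. -/
def tildePhi (K : Type*) [Field K] (n : ℕ) : Set (MvPolynomial (Fin n) K) :=
  {p | (∃ i j : Fin n, i < j ∧ p = X i - X j) ∨ (∃ i : Fin n, p = X i)}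

namespace Coinv

variable {K : Type*} [Field K] {n : ℕ}

/-- the Young-type subgroup of permutations preserving the colouring `c` -/
def yg (c : Fin n → Prop) : Finset (Equiv.Perm (Fin n)) := by
  classical
  exact Finset.univ.filter (fun w => ∀ i, c (w i) ↔ c i)

lemma mem_yg {c : Fin n → Prop} {w : Equiv.Perm (Fin n)} :
    w ∈ yg c ↔ ∀ i, c (w i) ↔ c i := by
  simp [yg]

/-- antisymmetrizer -/
def asym (c : Fin n → Prop) (f : MvPolynomial (Fin n) K) : MvPolynomial (Fin n) K :=
  ∑ w ∈ yg c, C ((Equiv.Perm.sign w : ℤ) : K) * rename w f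

lemma asym_add (c : Fin n → Prop) (f g : MvPolynomial (Fin n) K) :
    asym c (f + g) = asym c f + asym c g := by
  simp [asym, mul_add, Finset.sum_add_distrib]

lemma asym_zero (c : Fin n → Prop) : asym c (0 : MvPolynomial (Fin n) K) = 0 := by
  simp [asym]

lemma asym_mul (c : Fin n → Prop) (f s : MvPolynomial (Fin n) K) (hs : s.IsSymmetric) :
    asym c (f * s) = asym c f * s := by
  simp only [asym, Finset.sum_mul, map_mul]
  refine Finset.sum_congr rfl fun w _ => ?_
  rw [hs w, mul_assoc]

lemma rename_asym (c : Fin n → Prop) (f : MvPolynomial (Fin n) K) (u : Equiv.Perm (Fin n))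
    (hu : u ∈ yg c) :
    rename u (asym c f) = C ((Equiv.Perm.sign u : ℤ) : K) * asym c f := by
  simp only [asym, map_sum, Finset.mul_sum]
  refine Finset.sum_equiv (Equiv.mulLeft u) ?_ ?_
  · intro w
    simp only [mem_yg, Equiv.coe_mulLeft, Equiv.Perm.mul_apply]
    rw [mem_yg] at hu
    simp [hu]
  · intro w _
    simp only [map_mul, rename_C, Equiv.coe_mulLeft, rename_rename, Equiv.Perm.sign_mul,
      Equiv.Perm.coe_mul]
    rw [← mul_assoc, ← C_mul, Units.val_mul, Int.cast_mul, ← mul_assoc, ← Int.cast_mul,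
      ← Units.val_mul, Int.units_mul_self]
    simp

lemma sub_dvd_sub_subst (i j : Fin n) (f : MvPolynomial (Fin n) K) :
    (X i - X j : MvPolynomial (Fin n) K) ∣ f - aeval (fun k => if k = i then X j else X k) f := by
  induction f using MvPolynomial.induction_on with
  | C a => simp
  | add p q hp hq =>
    rw [map_add, add_sub_add_comm]
    exact dvd_add hp hq
  | mul_X p k hp =>
    rw [map_mul, aeval_X]
    have : p * X k - aeval (fun k => if k = i then X j else X k) p * (if k = i then X j else X k)
      = (p - aeval (fun k => if k = i then X j else X k) p) * X k
        + aeval (fun k => if k = i then X j else X k) p * (X k - if k = i then X j else X k) := by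
      ring
    rw [this]
    refine dvd_add (hp.mul_right _) (Dvd.dvd.mul_left ?_ _)
    split_ifs with h
    · subst h; rfl
    · simp

lemma sub_dvd_iff (i j : Fin n) (hij : i ≠ j) (f : MvPolynomial (Fin n) K) :
    (X i - X j : MvPolynomial (Fin n) K) ∣ f ↔
      aeval (fun k => if k = i then X j else X k : Fin n → MvPolynomial (Fin n) K) f = 0 := by
  constructor
  · rintro ⟨g, rfl⟩
    simp [hij.symm]
  · intro h
    have := sub_dvd_sub_subst i j f
    rwa [h, sub_zero] at this

lemma X_sub_ne (i j : Fin n) (hij : i ≠ j) : (X i - X j : MvPolynomial (Fin n) K) ≠ 0 := by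
  rw [sub_ne_zero]
  exact fun h => hij (X_injective h)

lemma X_sub_prime (i j : Fin n) (hij : i ≠ j) : Prime (X i - X j : MvPolynomial (Fin n) K) := by
  refine ⟨X_sub_ne i j hij, ?_, ?_⟩
  · intro h
    have := (sub_dvd_iff i j hij (1 : MvPolynomial (Fin n) K)).1 h.dvd
    simp at this
  · intro a b h
    rw [sub_dvd_iff i j hij] at h ⊢
    rw [sub_dvd_iff i j hij]
    simpa using h

lemma not_sub_dvd (i j k l : Fin n) (hij : i < j) (hkl : k < l) (h : (i, j) ≠ (k, l)) :
    ¬ (X i - X j : MvPolynomial (Fin n) K) ∣ X k - X l := by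
  rw [sub_dvd_iff i j hij.ne]
  simp only [map_sub, aeval_X, sub_eq_zero]
  have e : ∀ m : Fin n, (if m = i then X j else X m : MvPolynomial (Fin n) K)
    = X (if m = i then j else m) := by intro m; split_ifs <;> rfl
  rw [e, e]
  intro h'
  have := X_injective h'
  apply h
  split_ifs at this <;> simp_all <;> omega

lemma sub_dvd_of_swap [CharZero K] (i j : Fin n) (hij : i ≠ j) (f : MvPolynomial (Fin n) K)
    (h : rename (Equiv.swap i j) f = - f) : (X i - X j : MvPolynomial (Fin n) K) ∣ f := by
  rw [sub_dvd_iff i j hij]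
  have h2 := congrArg
    (aeval (fun k => if k = i then X j else X k : Fin n → MvPolynomial (Fin n) K)) h
  rw [aeval_rename, map_neg] at h2
  have : (fun k => if k = i then X j else X k : Fin n → MvPolynomial (Fin n) K) ∘ (Equiv.swap i j)
      = (fun k => if k = i then X j else X k : Fin n → MvPolynomial (Fin n) K) := by
    funext k
    simp only [Function.comp, Equiv.swap_apply_def]
    split_ifs <;> simp_all
  rw [this] at h2
  exact self_eq_neg.1 h2

/-- pairs `i < j` -/
def prs (n : ℕ) : Finset (Fin n × Fin n) := Finset.univ.filter (fun e => e.1 < e.2)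

lemma mem_prs {e : Fin n × Fin n} : e ∈ prs n ↔ e.1 < e.2 := by simp [prs]

open Classical in
lemma dvd_asym [CharZero K] (c : Fin n → Prop) (f : MvPolynomial (Fin n) K) :
    (∏ e ∈ (prs n).filter (fun e => c e.1 ↔ c e.2), (X e.1 - X e.2 : MvPolynomial (Fin n) K))
      ∣ asym c f := by
  apply Finset.prod_dvd_of_isRelPrime
  · rintro ⟨i, j⟩ h1 ⟨k, l⟩ h2 hne
    simp only [Finset.coe_filter, mem_prs, Set.mem_setOf_eq] at h1 h2
    exact ((X_sub_prime i j h1.1.ne).irreducible.isRelPrime_iff_not_dvd).2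
      (not_sub_dvd i j k l h1.1 h2.1 hne)
  · rintro ⟨i, j⟩ h1
    simp only [Finset.mem_filter, mem_prs] at h1
    apply sub_dvd_of_swap i j h1.1.ne
    rw [rename_asym]
    · rw [Equiv.Perm.sign_swap h1.1.ne]; simp
    · rw [mem_yg]
      intro k
      rw [Equiv.swap_apply_def]
      split_ifs with h h'
      · rw [h]; exact h1.2.symm
      · rw [h']; exact h1.2
      · rfl

/-- Vandermonde -/
def vdm (K : Type*) [Field K] (n : ℕ) : MvPolynomial (Fin n) K :=
  ∏ e ∈ prs n, (X e.1 - X e.2)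

lemma vdm_eq_det : vdm K n = (Matrix.vandermonde (fun i : Fin n => - X i :
    Fin n → MvPolynomial (Fin n) K)).det := by
  rw [Matrix.det_vandermonde, vdm, prs, Finset.prod_filter, ← Finset.univ_product_univ,
    Finset.prod_product]
  refine Finset.prod_congr rfl fun i _ => ?_
  rw [← Finset.prod_filter]
  refine Finset.prod_congr ?_ fun j _ => by ring
  ext j; simp

lemma rename_vdm (w : Equiv.Perm (Fin n)) :
    rename w (vdm K n) = C ((Equiv.Perm.sign w : ℤ) : K) * vdm K n := by
  have : C ((Equiv.Perm.sign w : ℤ) : K) = (((Equiv.Perm.sign w : ℤ)) : MvPolynomial (Fin n) K) := by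
    simp
  rw [this, vdm_eq_det, ← Matrix.det_permute, AlgHom.map_det]
  congr 1
  ext i j : 2
  simp [Matrix.vandermonde]

lemma vdm_ne : vdm K n ≠ 0 := by
  rw [vdm, Finset.prod_ne_zero_iff]
  intro e he
  exact X_sub_ne _ _ (mem_prs.1 he).ne

lemma dvd_vdm (b : Fin n) :
    (∏ i ∈ Finset.univ.erase b, (X b - X i) : MvPolynomial (Fin n) K) ∣ vdm K n := by
  have h1 : (∏ i ∈ Finset.univ.erase b, (X b - X i) : MvPolynomial (Fin n) K) ∣
      ∏ i ∈ Finset.univ.erase b, (X (min b i) - X (max b i)) := by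
    apply Finset.prod_dvd_prod_of_dvd
    intro i _
    rcases le_total b i with h | h
    · simp [h]
    · rw [min_eq_right h, max_eq_left h, ← neg_sub, neg_dvd]
  refine h1.trans ?_
  have h2 : ∏ i ∈ Finset.univ.erase b, (X (min b i) - X (max b i) : MvPolynomial (Fin n) K)
    = ∏ e ∈ (Finset.univ.erase b).image (fun i => (min b i, max b i)), (X e.1 - X e.2) := by
    rw [Finset.prod_image]
    intro i hi j hj h
    simp only [Prod.mk.injEq] at h
    grind
  rw [h2, vdm]
  apply Finset.prod_dvd_prod_of_subset
  intro e he
  simp only [Finset.mem_image, Finset.mem_erase] at he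
  obtain ⟨i, hi, rfl⟩ := he
  rw [mem_prs]
  grind

open Polynomial in
lemma key_mem (b : Fin n) :
    (X b * ∏ i ∈ Finset.univ.erase b, (X b - X i) : MvPolynomial (Fin n) K) ∈ coinvIdeal K n := by
  set P : (MvPolynomial (Fin n) K)[X] := ∏ i, (Polynomial.X - Polynomial.C (X i)) with hP
  have hc : ∀ k, (P - Polynomial.X ^ n).coeff k ∈ coinvIdeal K n := by
    intro k
    apply Ideal.subset_span
    constructor
    · intro w
      have : (P - Polynomial.X ^ n).map (rename w : MvPolynomial (Fin n) K →ₐ[K] _).toRingHom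
          = P - Polynomial.X ^ n := by
        simp only [hP, Polynomial.map_sub, Polynomial.map_prod, Polynomial.map_X,
          Polynomial.map_C, Polynomial.map_pow]
        congr 1
        simp only [AlgHom.toRingHom_eq_coe, RingHom.coe_coe, rename_X]
        exact Equiv.prod_comp w (fun i => (Polynomial.X - Polynomial.C (X i)
          : (MvPolynomial (Fin n) K)[X]))
      conv_rhs => rw [← this]
      rw [Polynomial.coeff_map]; rfl
    · have : (P - Polynomial.X ^ n).map (constantCoeff : MvPolynomial (Fin n) K →+* K) = 0 := by
        simp [hP, Polynomial.map_prod]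
      rw [← Polynomial.coeff_map, this, Polynomial.coeff_zero]
  set q := Ideal.Quotient.mk (coinvIdeal K n)
  have hmap : P.map q = Polynomial.X ^ n := by
    rw [← sub_eq_zero]
    ext k
    have := Ideal.Quotient.eq_zero_iff_mem.2 (hc k)
    rw [← Polynomial.coeff_map] at this
    simpa using this
  have hder : (P.derivative).eval (X b) = ∏ i ∈ Finset.univ.erase b, (X b - X i) := by
    rw [hP, Polynomial.derivative_prod_finset, Polynomial.eval_finset_sum,
      Finset.sum_eq_single b]
    · simp [Polynomial.eval_prod]
    · intro i _ hi
      simp only [Polynomial.eval_mul, Polynomial.eval_prod]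
      rw [Finset.prod_eq_zero (i := b)]
      · simp
      · simp [hi.symm]
      · simp
    · simp
  have h0 : P.eval (X b) = 0 := by
    rw [hP, Polynomial.eval_prod, Finset.prod_eq_zero (Finset.mem_univ b)]
    simp
  rw [← Ideal.Quotient.eq_zero_iff_mem, map_mul, ← hder]
  change q (X b) * q _ = 0
  have e1 : q (X b) ^ n = 0 := by
    have := congrArg q h0
    rw [← Polynomial.eval_map_apply, hmap] at this
    simpa using this
  rw [← Polynomial.eval_map_apply, ← Polynomial.derivative_map, hmap, Polynomial.derivative_X_pow]
  rcases n with _ | n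
  · exact b.elim0
  · simp only [Nat.add_sub_cancel, Polynomial.eval_mul, Polynomial.eval_pow, Polynomial.eval_X]
    rw [mul_left_comm, ← pow_succ', e1, mul_zero]

lemma X_mul_vdm_mem (b : Fin n) : X b * vdm K n ∈ coinvIdeal K n :=
  Ideal.mem_of_dvd _ (mul_dvd_mul_left _ (dvd_vdm b)) (key_mem b)

open Classical in
lemma asym_mem [CharZero K] (c : Fin n → Prop) (f : MvPolynomial (Fin n) K)
    (hf : f ∈ coinvIdeal K n) :
    ∃ q ∈ coinvIdeal K n, asym c f =
      (∏ e ∈ (prs n).filter (fun e => c e.1 ↔ c e.2), (X e.1 - X e.2)) * q := by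
  suffices ∀ a, ∃ q ∈ coinvIdeal K n, asym c (a * f) =
      (∏ e ∈ (prs n).filter (fun e => c e.1 ↔ c e.2), (X e.1 - X e.2)) * q by
    simpa using this 1
  unfold coinvIdeal at hf
  induction hf using Submodule.span_induction with
  | mem s hs =>
    intro a
    obtain ⟨q, hq⟩ := dvd_asym c a
    refine ⟨q * s, Ideal.mul_mem_left _ _ (Ideal.subset_span hs), ?_⟩
    rw [asym_mul _ _ _ hs.1, hq, mul_assoc]
  | zero => intro a; exact ⟨0, Ideal.zero_mem _, by simp [asym_zero]⟩
  | add x y _ _ hx hy =>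
    intro a
    obtain ⟨q, hq, e⟩ := hx a
    obtain ⟨q', hq', e'⟩ := hy a
    exact ⟨q + q', Ideal.add_mem _ hq hq', by rw [mul_add, asym_add, e, e', mul_add]⟩
  | smul b x _ hx =>
    intro a
    rw [smul_eq_mul, ← mul_assoc]
    exact hx _

open Classical in
/-- Cut products lie in the coinvariant ideal. -/
lemma cut_mem [CharZero K] (c : Fin n → Prop) (b : Fin n) (hb : ¬ c b) :
    (∏ i ∈ Finset.univ.filter (fun i => ¬ c i), X i) *
      (∏ e ∈ (prs n).filter (fun e => ¬ (c e.1 ↔ c e.2)), (X e.1 - X e.2))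
        ∈ coinvIdeal K n := by
  set xB : MvPolynomial (Fin n) K := ∏ i ∈ Finset.univ.filter (fun i => ¬ c i), X i with hxB
  set F : MvPolynomial (Fin n) K :=
    ∏ e ∈ (prs n).filter (fun e => ¬ (c e.1 ↔ c e.2)), (X e.1 - X e.2) with hF
  set p : MvPolynomial (Fin n) K :=
    ∏ e ∈ (prs n).filter (fun e => c e.1 ↔ c e.2), (X e.1 - X e.2) with hp
  have hpF : p * F = vdm K n := Finset.prod_filter_mul_prod_filter_not _ _ _
  have hmem : xB * vdm K n ∈ coinvIdeal K n := by
    refine Ideal.mem_of_dvd _ (mul_dvd_mul_right ?_ _) (X_mul_vdm_mem b)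
    exact Finset.dvd_prod_of_mem _ (by simp [hb])
  have hren : ∀ w ∈ yg c, rename w xB = xB := by
    intro w hw
    rw [mem_yg] at hw
    rw [hxB, map_prod]
    simp only [rename_X]
    refine Finset.prod_equiv w ?_ ?_
    · intro i; simp [hw]
    · intro i _; rfl
  have has : asym c (xB * vdm K n) = C ((yg c).card : K) * (xB * vdm K n) := by
    rw [asym, Finset.sum_congr rfl (g := fun _ => xB * vdm K n), Finset.sum_const, nsmul_eq_mul]
    · simp
    · intro w hw
      rw [map_mul, hren w hw, rename_vdm, mul_left_comm, ← mul_assoc (C _), ← C_mul,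
        ← Int.cast_mul, ← Units.val_mul, Int.units_mul_self]
      simp
  obtain ⟨q, hq, e⟩ := asym_mem c _ hmem
  rw [has] at e
  have hp0 : p ≠ 0 := by
    intro h
    rw [h, zero_mul] at hpF
    exact vdm_ne hpF.symm
  have e2 : C ((yg c).card : K) * (xB * F) = q := by
    apply mul_left_cancel₀ hp0
    rw [← hp] at e
    rw [← e, ← hpF]; ring
  have hcard : ((yg c).card : K) ≠ 0 := by
    rw [Nat.cast_ne_zero]
    exact Finset.card_ne_zero_of_mem (a := 1) (by rw [mem_yg]; simp)
  have : xB * F = C (((yg c).card : K)⁻¹) * q := by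
    rw [← e2, ← mul_assoc, ← C_mul, inv_mul_cancel₀ hcard, C_1, one_mul]
  rw [this]
  exact Ideal.mul_mem_left _ _ hq

/-! ### The top-degree functional -/

/-- staircase exponent -/
def stair (n : ℕ) : Fin n →₀ ℕ := ∑ e ∈ prs n, Finsupp.single e.1 1

lemma stair_apply (i : Fin n) : stair n i = n - 1 - i := by
  rw [stair, Finsupp.finset_sum_apply, prs, Finset.sum_filter, ← Finset.univ_product_univ,
    Finset.sum_product, Finset.sum_eq_single i]
  · simp [← Finset.sum_filter]
    rw [← Fin.card_Ioi]
    congr 1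
    ext j; simp
  · intro k _ hk
    simp [hk]
  · simp

lemma eq_stair (β : Fin n →₀ ℕ) (hle : β ≤ stair n) (hinj : Function.Injective β) :
    β = stair n := by
  have hle' : ∀ i, β i ≤ n - 1 - i := fun i => stair_apply i ▸ hle i
  have : ∀ m : ℕ, ∀ i : Fin n, n - 1 - (i : ℕ) = m → β i = m := by
    intro m
    induction m using Nat.strong_induction_on with
    | _ m ih =>
      intro i hi
      by_contra hne
      have h1 : β i < m := lt_of_le_of_ne (hi ▸ hle' i) hne
      have hlt : n - 1 - β i < n := by omega
      have h2 := ih (β i) h1 ⟨n - 1 - β i, hlt⟩ (by simp; omega)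
      have h3 := hinj h2
      have h4 := congrArg Fin.val h3
      simp at h4
      omega
  ext i
  rw [stair_apply, this _ i rfl]

lemma coeff_asym_eq_zero [CharZero K] (f : MvPolynomial (Fin n) K) (β : Fin n →₀ ℕ)
    (hβ : ¬ Function.Injective β) : coeff β (asym (fun _ => True) f) = 0 := by
  simp only [Function.Injective, not_forall] at hβ
  obtain ⟨i, j, hij, hne⟩ := hβ
  have h := rename_asym (fun _ => True) f (Equiv.swap i j) (by simp [mem_yg])
  rw [Equiv.Perm.sign_swap hne] at h
  have h2 := congrArg (coeff β) h
  have e : Finsupp.mapDomain (Equiv.swap i j) β = β := by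
    ext k
    have := Finsupp.mapDomain_apply (Equiv.swap i j).injective β (Equiv.swap i j k)
    rw [Equiv.swap_apply_self] at this
    rw [this, Equiv.swap_apply_def]
    split_ifs <;> simp_all
  nth_rewrite 1 [← e] at h2
  rw [coeff_rename_mapDomain _ (Equiv.swap i j).injective] at h2
  simp only [Units.val_neg, Units.val_one, Int.cast_neg, Int.cast_one, map_neg, map_one,
    neg_mul, one_mul, coeff_neg] at h2
  exact self_eq_neg.1 h2

lemma functional_zero [CharZero K] (f : MvPolynomial (Fin n) K) (hf : f ∈ coinvIdeal K n) :
    coeff (stair n) (asym (fun _ => True) f) = 0 := by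
  suffices ∀ a, coeff (stair n) (asym (fun _ => True) (a * f)) = 0 by simpa using this 1
  unfold coinvIdeal at hf
  induction hf using Submodule.span_induction with
  | mem s hs =>
    intro a
    rw [asym_mul _ _ _ hs.1, coeff_mul]
    apply Finset.sum_eq_zero
    rintro ⟨β, γ⟩ h
    rw [Finset.HasAntidiagonal.mem_antidiagonal] at h
    dsimp only at h ⊢
    by_cases hβ : Function.Injective β
    · have h1 := eq_stair β (h ▸ le_self_add) hβ
      have h2 : γ = 0 := by
        rw [h1] at h
        simpa using h
      have h3 : coeff γ s = 0 := by rw [h2]; exact hs.2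
      rw [h3, mul_zero]
    · rw [coeff_asym_eq_zero _ _ hβ, zero_mul]
  | zero => intro a; simp [asym_zero]
  | add x y _ _ hx hy =>
    intro a
    rw [mul_add, asym_add, coeff_add, hx, hy, add_zero]
  | smul b x _ hx =>
    intro a
    rw [smul_eq_mul, ← mul_assoc]
    exact hx _

/-! ### Vertices -/

/-- the variables, with an extra vertex carrying `0` -/
def yy (K : Type*) [Field K] {n : ℕ} (v : Fin (n + 1)) : MvPolynomial (Fin n) K :=
  Fin.lastCases (motive := fun _ => MvPolynomial (Fin n) K) 0 X v

@[simp] lemma yy_last : yy K (Fin.last n) = 0 := by simp [yy]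

@[simp] lemma yy_castSucc (i : Fin n) : yy K i.castSucc = X i := by simp [yy]

lemma yy_mem_tildePhi (i j : Fin (n + 1)) (hij : i < j) : yy K i - yy K j ∈ tildePhi K n := by
  induction j using Fin.lastCases with
  | last =>
    induction i using Fin.lastCases with
    | last => exact absurd hij (lt_irrefl _)
    | cast i => right; exact ⟨i, by simp⟩
  | cast j =>
    induction i using Fin.lastCases with
    | last => exact absurd hij (not_lt.2 (Fin.le_last _))
    | cast i => left; exact ⟨i, j, by simpa using hij, by simp⟩

lemma tildePhi_exists (α : MvPolynomial (Fin n) K) (h : α ∈ tildePhi K n) :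
    ∃ i j : Fin (n + 1), i < j ∧ α = yy K i - yy K j := by
  rcases h with ⟨i, j, hij, rfl⟩ | ⟨i, rfl⟩
  · exact ⟨i.castSucc, j.castSucc, by simpa using hij, by simp⟩
  · exact ⟨i.castSucc, Fin.last n, Fin.castSucc_lt_last i, by simp⟩

lemma prod_prs_succ {M : Type*} [CommMonoid M] (f : Fin (n + 1) × Fin (n + 1) → M) :
    ∏ e ∈ prs (n + 1), f e = (∏ i : Fin n, f (i.castSucc, Fin.last n)) *
      ∏ e ∈ prs n, f (e.1.castSucc, e.2.castSucc) := by
  simp only [prs, Finset.prod_filter, ← Finset.univ_product_univ, Finset.prod_product]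
  rw [Fin.prod_univ_castSucc]
  have : ∏ y, (if Fin.last n < y then f (Fin.last n, y) else 1) = 1 := by
    apply Finset.prod_eq_one
    intro y _
    rw [if_neg (not_lt.2 (Fin.le_last _))]
  rw [this, mul_one, ← Finset.prod_mul_distrib]
  refine Finset.prod_congr rfl fun i _ => ?_
  rw [Fin.prod_univ_castSucc, mul_comm]
  simp [Fin.castSucc_lt_last]

lemma yy_injective : Function.Injective (yy K : Fin (n + 1) → _) := by
  intro i j h
  induction j using Fin.lastCases with
  | last =>
    induction i using Fin.lastCases with
    | last => rfl
    | cast i => simp at h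
  | cast j =>
    induction i using Fin.lastCases with
    | last => simp at h; exact absurd h.symm (X_ne_zero j)
    | cast i => simp at h; rw [h]

lemma ell_injOn [CharZero K] :
    Set.InjOn (fun e : Fin (n + 1) × Fin (n + 1) => yy K e.1 - yy K e.2) (prs (n + 1)) := by
  rintro ⟨i, j⟩ h1 ⟨k, l⟩ h2 h
  simp only [Finset.mem_coe, mem_prs] at h1 h2
  dsimp only at h
  induction i using Fin.lastCases with
  | last => exact absurd h1 (not_lt.2 (Fin.le_last _))
  | cast i =>
    have key : ∀ v : Fin (n + 1), eval (fun t : Fin n => if t = i then (1 : K) else 0) (yy K v)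
        = if v = i.castSucc then 1 else 0 := by
      intro v
      induction v using Fin.lastCases with
      | last => simp [(Fin.castSucc_lt_last i).ne']
      | cast v => simp
    have h3 := congrArg (eval (fun t : Fin n => if t = i then (1 : K) else 0)) h
    simp only [map_sub, key] at h3
    have hk : k = i.castSucc := by
      by_contra hk
      rw [if_pos trivial, if_neg h1.ne', if_neg hk] at h3
      split_ifs at h3
      · have : (2 : K) = 0 := by linear_combination h3
        exact two_ne_zero this
      · simp at h3
    subst hk
    rw [sub_right_inj] at h
    rw [yy_injective h]

/-! ### Leading terms -/

lemma deg_yy_sub (i : Fin n) (v : Fin (n + 1)) (h : i.castSucc < v) :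
    MonomialOrder.lex.degree (X i - yy K v) = Finsupp.single i 1 ∧
      MonomialOrder.lex.leadingCoeff (X i - yy K v) = 1 := by
  induction v using Fin.lastCases with
  | last => simp [MonomialOrder.degree_X]
  | cast j =>
    have : MonomialOrder.lex.toSyn (MonomialOrder.lex.degree (yy K j.castSucc)) <
      MonomialOrder.lex.toSyn (MonomialOrder.lex.degree (X i : MvPolynomial (Fin n) K)) := by
      rw [yy_castSucc, MonomialOrder.degree_X, MonomialOrder.degree_X, MonomialOrder.lex_lt_iff,
        Finsupp.Lex.single_lt_iff]
      simpa using h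
    rw [MonomialOrder.degree_sub_of_lt this, MonomialOrder.leadingCoeff_sub_of_lt this]
    simp [MonomialOrder.degree_X]

lemma deg_vdm : MonomialOrder.lex.degree (vdm K n) = stair n ∧
    MonomialOrder.lex.leadingCoeff (vdm K n) = 1 := by
  have h : ∀ e ∈ prs n, MonomialOrder.lex.degree (X e.1 - X e.2 : MvPolynomial (Fin n) K)
      = Finsupp.single e.1 1 ∧
      MonomialOrder.lex.leadingCoeff (X e.1 - X e.2 : MvPolynomial (Fin n) K) = 1 := by
    intro e he
    have := deg_yy_sub (K := K) e.1 e.2.castSucc (by simpa using mem_prs.1 he)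
    simpa using this
  constructor
  · rw [vdm, MonomialOrder.degree_prod]
    · exact Finset.sum_congr rfl fun e he => (h e he).1
    · intro e he
      exact X_sub_ne _ _ (mem_prs.1 he).ne
  · exact MonomialOrder.Monic.prod fun e he => (h e he).2

/-- extension of a permutation fixing the last vertex -/
def extPerm (w : Fin n → Fin n) (v : Fin (n + 1)) : Fin (n + 1) :=
  Fin.lastCases (motive := fun _ => Fin (n + 1)) (Fin.last n) (fun i => (w i).castSucc) v

@[simp] lemma extPerm_last (w : Fin n → Fin n) : extPerm w (Fin.last n) = Fin.last n := by simp [extPerm]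

@[simp] lemma extPerm_castSucc (w : Fin n → Fin n) (i : Fin n) :
    extPerm w i.castSucc = (w i).castSucc := by simp [extPerm]

lemma rename_yy (w : Fin n → Fin n) (v : Fin (n + 1)) :
    rename w (yy K v) = yy K (extPerm w v) := by
  induction v using Fin.lastCases with
  | last => simp
  | cast v => simp

lemma extPerm_injective (w : Equiv.Perm (Fin n)) : Function.Injective (extPerm w) := by
  intro i j h
  induction j using Fin.lastCases with
  | last =>
    induction i using Fin.lastCases with
    | last => rfl
    | cast i => simp at h
  | cast j =>
    induction i using Fin.lastCases with
    | last => simp at h; exact absurd h.symm (Fin.castSucc_lt_last _).ne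
    | cast i => simpa using h

/-- coefficient computation for one permutation -/
lemma coeff_one (par : Fin n → Fin (n + 1)) (hpar : ∀ v, par v ≠ v.castSucc)
    (g : MvPolynomial (Fin n) K) (ε : K) (hε : ε ≠ 0)
    (hg : g * ∏ v, (X v - yy K (par v)) = C ε * ((∏ i, X i) * vdm K n))
    (w : Equiv.Perm (Fin n)) :
    ((Equiv.Perm.sign w : ℤ) : K) * coeff (stair n) (rename w g) =
      open Classical in if ∀ v, (w v).castSucc < extPerm w (par v) then ε else 0 := by
  classical
  have hss : ((Equiv.Perm.sign w : ℤ) : K) * ((Equiv.Perm.sign w : ℤ) : K) = 1 := by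
    rw [← Int.cast_mul, ← Units.val_mul, Int.units_mul_self]; simp
  have hs0 : ((Equiv.Perm.sign w : ℤ) : K) ≠ 0 := left_ne_zero_of_mul_eq_one hss
  have h1 := congrArg (rename w) hg
  rw [map_mul, map_mul, map_mul, rename_vdm, map_prod, map_prod, rename_C] at h1
  simp only [map_sub, rename_X, rename_yy] at h1
  rw [Equiv.prod_comp w (fun i => (X i : MvPolynomial (Fin n) K))] at h1
  have hne : ∀ v, (X (w v) - yy K (extPerm w (par v)) : MvPolynomial (Fin n) K) ≠ 0 := by
    intro v h
    rw [sub_eq_zero, ← yy_castSucc] at h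
    have := yy_injective h
    rw [← extPerm_castSucc] at this
    exact hpar v (extPerm_injective w this).symm
  set L : MvPolynomial (Fin n) K := ∏ v, (X (w v) - yy K (extPerm w (par v))) with hL
  have hL0 : L ≠ 0 := Finset.prod_ne_zero_iff.2 fun v _ => hne v
  have hXne : (∏ i, X i : MvPolynomial (Fin n) K) ≠ 0 :=
    Finset.prod_ne_zero_iff.2 fun v _ => X_ne_zero v
  have hR : C ε * ((∏ i, X i) * (C ((Equiv.Perm.sign w : ℤ) : K) * vdm K n))
    = C (ε * ((Equiv.Perm.sign w : ℤ) : K)) * ((∏ i, X i) * vdm K n) := by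
    rw [C_mul]; ring
  rw [hR] at h1
  have hc0 : ε * ((Equiv.Perm.sign w : ℤ) : K) ≠ 0 := mul_ne_zero hε hs0
  have hR0 : C (ε * ((Equiv.Perm.sign w : ℤ) : K)) * ((∏ i, X i) * vdm K n) ≠ 0 :=
    mul_ne_zero (C_ne_zero.2 hc0) (mul_ne_zero hXne vdm_ne)
  have hg0 : rename w g ≠ 0 := by
    intro h
    rw [h, zero_mul] at h1
    exact hR0 h1.symm
  have hXdeg : MonomialOrder.lex.degree (∏ i, X i : MvPolynomial (Fin n) K)
      = ∑ v : Fin n, Finsupp.single v 1 := by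
    rw [MonomialOrder.degree_prod (fun i _ => X_ne_zero i)]
    simp [MonomialOrder.degree_X]
  have hd := congrArg (MonomialOrder.lex.degree) h1
  have hl := congrArg (MonomialOrder.lex.leadingCoeff) h1
  rw [MonomialOrder.degree_mul hg0 hL0, MonomialOrder.degree_mul (C_ne_zero.2 hc0)
    (mul_ne_zero hXne vdm_ne), MonomialOrder.degree_mul hXne vdm_ne, deg_vdm.1, hXdeg,
    MonomialOrder.degree_C, zero_add] at hd
  have hXl : MonomialOrder.lex.leadingCoeff (∏ i, X i : MvPolynomial (Fin n) K) = 1 :=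
    MonomialOrder.Monic.prod fun i _ => MonomialOrder.monic_X
  rw [MonomialOrder.leadingCoeff_mul, MonomialOrder.leadingCoeff_mul,
    MonomialOrder.leadingCoeff_mul, deg_vdm.2, hXl, MonomialOrder.leadingCoeff_C, mul_one,
    mul_one] at hl
  have hLd : MonomialOrder.lex.degree L
      = ∑ v, MonomialOrder.lex.degree (X (w v) - yy K (extPerm w (par v))) :=
    MonomialOrder.degree_prod fun v _ => hne v
  have hsw : ∑ v : Fin n, (Finsupp.single v 1 : Fin n →₀ ℕ) = ∑ v, Finsupp.single (w v) 1 :=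
    (Equiv.sum_comp w (fun v => (Finsupp.single v 1 : Fin n →₀ ℕ))).symm
  split_ifs with hgood
  · have hL1 : MonomialOrder.lex.leadingCoeff L = 1 :=
      MonomialOrder.Monic.prod fun v _ => (deg_yy_sub _ _ (hgood v)).2
    have hLd' : MonomialOrder.lex.degree L = ∑ v : Fin n, Finsupp.single v 1 := by
      rw [hLd, hsw]
      exact Finset.sum_congr rfl fun v _ => (deg_yy_sub _ _ (hgood v)).1
    rw [hLd', add_comm, add_right_inj] at hd
    rw [hL1, mul_one, MonomialOrder.leadingCoeff, hd] at hl
    rw [hl, mul_left_comm, hss, mul_one]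
  · have hbad : ∀ v, ¬ (w v).castSucc < extPerm w (par v) →
        MonomialOrder.lex.toSyn (Finsupp.single (w v) 1) < MonomialOrder.lex.toSyn
          (MonomialOrder.lex.degree (X (w v) - yy K (extPerm w (par v)))) := by
      intro v hv
      have hlt : extPerm w (par v) < (w v).castSucc := by
        refine lt_of_le_of_ne (not_lt.1 hv) ?_
        intro h
        rw [← extPerm_castSucc] at h
        exact hpar v (extPerm_injective w h)
      generalize extPerm w (par v) = u at hlt ⊢
      induction u using Fin.lastCases with
      | last => exact absurd hlt (not_lt.2 (Fin.le_last _))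
      | cast u =>
        rw [← neg_sub, MonomialOrder.degree_neg, yy_castSucc, ← yy_castSucc (w v),
          (deg_yy_sub _ _ hlt).1, MonomialOrder.lex_lt_iff, Finsupp.Lex.single_lt_iff]
        simpa using hlt
    have hlt : MonomialOrder.lex.toSyn (∑ v : Fin n, Finsupp.single v 1) <
        MonomialOrder.lex.toSyn (MonomialOrder.lex.degree L) := by
      rw [hLd, hsw, map_sum, map_sum]
      push Not at hgood
      obtain ⟨v0, hv0⟩ := hgood
      refine Finset.sum_lt_sum ?_ ⟨v0, Finset.mem_univ _, hbad v0 (not_lt.2 hv0)⟩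
      intro v _
      by_cases hv : (w v).castSucc < extPerm w (par v)
      · rw [(deg_yy_sub _ _ hv).1]
      · exact (hbad v hv).le
    have hlt2 : MonomialOrder.lex.toSyn (MonomialOrder.lex.degree (rename w g)) <
        MonomialOrder.lex.toSyn (stair n) := by
      have hd' := congrArg MonomialOrder.lex.toSyn hd
      rw [map_add, map_add] at hd'
      by_contra hcon
      have := add_lt_add_of_lt_of_le hlt (not_lt.1 hcon)
      rw [← hd', add_comm] at this
      exact lt_irrefl _ this
    rw [MonomialOrder.coeff_eq_zero_of_lt hlt2, mul_zero]

/-- A tree complement product is not in the coinvariant ideal. -/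
lemma tree_not_mem [CharZero K] (par : Fin n → Fin (n + 1)) (r : Fin (n + 1) → ℕ)
    (hr : ∀ v, r (par v) < r v.castSucc)
    (g : MvPolynomial (Fin n) K) (ε : K) (hε : ε ≠ 0)
    (hg : g * ∏ v, (X v - yy K (par v)) = C ε * ((∏ i, X i) * vdm K n)) :
    g ∉ coinvIdeal K n := by
  classical
  intro hmem
  have h := functional_zero g hmem
  have hpar : ∀ v, par v ≠ v.castSucc := fun v h => by
    have := hr v
    rw [h] at this
    exact lt_irrefl _ this
  rw [asym, coeff_sum] at h
  simp only [coeff_C_mul, coeff_one par hpar g ε hε hg] at h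
  rw [← Finset.sum_filter, Finset.sum_const, nsmul_eq_mul, mul_eq_zero, or_iff_left hε,
    Nat.cast_eq_zero, Finset.card_eq_zero] at h
  set f : Fin n → ℤ := fun i => - (r i.castSucc : ℤ) with hf
  have hmono := Tuple.monotone_sort f
  have hw : ∀ u v, f u < f v → (Tuple.sort f)⁻¹ u < (Tuple.sort f)⁻¹ v := by
    intro u v huv
    by_contra hcon
    have := hmono (not_lt.1 hcon)
    simp at this
    omega
  have : (Tuple.sort f)⁻¹ ∈ (yg (n := n) (fun _ => True)).filter
      (fun w : Equiv.Perm (Fin n) => ∀ v, (w v).castSucc < extPerm w (par v)) := by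
    rw [Finset.mem_filter]
    refine ⟨by simp [mem_yg], fun v => ?_⟩
    have hrv := hr v
    generalize par v = u at hrv
    induction u using Fin.lastCases with
    | last => simp [Fin.castSucc_lt_last]
    | cast u =>
      rw [extPerm_castSucc, Fin.castSucc_lt_castSucc_iff]
      apply hw
      simp only [hf]; omega
  rw [h] at this
  simp at this

/-! ### Spanning gives a rooted tree -/

lemma exists_tree [CharZero K] (T : Finset (MvPolynomial (Fin n) K))
    (hspan : Submodule.span K (tildePhi K n \ ↑T) =
        Submodule.span K (Set.range (X : Fin n → MvPolynomial (Fin n) K))) :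
    ∃ (par : Fin n → Fin (n + 1)) (r : Fin (n + 1) → ℕ),
      (∀ v, r (par v) < r v.castSucc) ∧
      ∀ v, yy K (min v.castSucc (par v)) - yy K (max v.castSucc (par v)) ∉ T := by
  classical
  let G : SimpleGraph (Fin (n + 1)) :=
    { Adj := fun u v => u ≠ v ∧ yy K (min u v) - yy K (max u v) ∉ T
      symm := ⟨fun u v h => ⟨h.1.symm, by rw [min_comm, max_comm]; exact h.2⟩⟩
      loopless := ⟨fun u h => h.1 rfl⟩ }
  have hadj : ∀ u v, G.Adj u v ↔ u ≠ v ∧ yy K (min u v) - yy K (max u v) ∉ T := fun _ _ => Iff.rfl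
  let ψ : MvPolynomial (Fin n) K →ₐ[K] K :=
    aeval (fun i => if G.Reachable i.castSucc (Fin.last n) then (0 : K) else 1)
  have hψ : ∀ v, ψ (yy K v) = if G.Reachable v (Fin.last n) then 0 else 1 := by
    intro v
    induction v using Fin.lastCases with
    | last => simp
    | cast v => simp [ψ]
  have hle : Submodule.span K (tildePhi K n \ ↑T) ≤ LinearMap.ker ψ.toLinearMap := by
    rw [Submodule.span_le]
    rintro α ⟨hα, hαT⟩
    obtain ⟨i, j, hij, rfl⟩ := tildePhi_exists α hα
    have ha : G.Adj i j := by
      rw [hadj, min_eq_left hij.le, max_eq_right hij.le]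
      exact ⟨hij.ne, hαT⟩
    have hiff : G.Reachable i (Fin.last n) ↔ G.Reachable j (Fin.last n) :=
      ⟨fun h => ha.reachable.symm.trans h, fun h => ha.reachable.trans h⟩
    simp [hψ, hiff]
  have hreach : ∀ v, G.Reachable v (Fin.last n) := by
    intro v
    induction v using Fin.lastCases with
    | last => exact SimpleGraph.Reachable.refl _
    | cast v =>
      have hX : (X v : MvPolynomial (Fin n) K) ∈ Submodule.span K (tildePhi K n \ ↑T) := by
        rw [hspan]
        exact Submodule.subset_span ⟨v, rfl⟩
      have := hle hX
      by_contra hcon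
      have h2 := hψ v.castSucc
      rw [if_neg hcon, yy_castSucc] at h2
      have h3 : ψ (X v) = 0 := this
      rw [h3] at h2
      exact zero_ne_one h2
  have hpar : ∀ v : Fin n, ∃ u, G.dist u (Fin.last n) < G.dist v.castSucc (Fin.last n) ∧
      G.Adj v.castSucc u := by
    intro v
    obtain ⟨p, hp⟩ := (hreach v.castSucc).exists_walk_length_eq_dist
    have hne : v.castSucc ≠ Fin.last n := (Fin.castSucc_lt_last v).ne
    generalize v.castSucc = a at p hp hne
    cases p with
    | nil => exact absurd rfl hne
    | cons h q =>
      refine ⟨_, ?_, h⟩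
      have := SimpleGraph.dist_le q
      rw [SimpleGraph.Walk.length_cons] at hp
      omega
  choose par h1 h2 using hpar
  exact ⟨par, fun u => G.dist u (Fin.last n), h1, fun v => ((hadj _ _).1 (h2 v)).2⟩

lemma not_mem_of_span [CharZero K] (T : Finset (MvPolynomial (Fin n) K))
    (hT : ↑T ⊆ tildePhi K n)
    (hspan : Submodule.span K (tildePhi K n \ ↑T) =
        Submodule.span K (Set.range (X : Fin n → MvPolynomial (Fin n) K))) :
    (∏ α ∈ T, α) ∉ coinvIdeal K n := by
  classical
  obtain ⟨par, r, hr, hnot⟩ := exists_tree T hspan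
  let ed : Fin n → Fin (n + 1) × Fin (n + 1) :=
    fun v => (min v.castSucc (par v), max v.castSucc (par v))
  have hpar : ∀ v, par v ≠ v.castSucc := fun v h => by
    have := hr v
    rw [h] at this
    exact lt_irrefl _ this
  have hed : Function.Injective ed := by
    intro u v h
    by_contra hne
    simp only [ed, Prod.mk.injEq] at h
    have hne' : u.castSucc ≠ v.castSucc := fun h => hne (Fin.castSucc_injective _ h)
    have h1 : u.castSucc = par v ∧ v.castSucc = par u := by
      generalize u.castSucc = a at *
      generalize v.castSucc = b at *
      generalize par u = a' at *
      generalize par v = b' at *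
      grind
    have h2 := hr u
    have h3 := hr v
    rw [← h1.1] at h3
    rw [← h1.2] at h2
    omega
  let τ := Finset.univ.image ed
  have hτ : τ ⊆ prs (n + 1) := by
    intro e he
    obtain ⟨v, _, rfl⟩ := Finset.mem_image.1 he
    rw [mem_prs]
    exact min_lt_max.2 (hpar v).symm
  let ℓ : Fin (n + 1) × Fin (n + 1) → MvPolynomial (Fin n) K := fun e => yy K e.1 - yy K e.2
  have hfull : ∏ e ∈ prs (n + 1), ℓ e = (∏ i, X i) * vdm K n := by
    rw [prod_prs_succ]
    simp [ℓ, vdm]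
  have hsplit : (∏ e ∈ prs (n + 1) \ τ, ℓ e) * ∏ e ∈ τ, ℓ e = (∏ i, X i) * vdm K n := by
    rw [Finset.prod_sdiff hτ, hfull]
  let s : Fin n → K := fun v => if v.castSucc < par v then 1 else -1
  have hs : ∀ v, ℓ (ed v) = C (s v) * (X v - yy K (par v)) := by
    intro v
    simp only [ℓ, ed, s]
    split_ifs with h
    · rw [min_eq_left h.le, max_eq_right h.le]; simp
    · rw [min_eq_right (not_lt.1 h), max_eq_left (not_lt.1 h)]; simp
  have hs2 : ∀ v, s v * s v = 1 := by
    intro v; simp only [s]; split_ifs <;> simp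
  have hτp : ∏ e ∈ τ, ℓ e = C (∏ v, s v) * ∏ v, (X v - yy K (par v)) := by
    rw [Finset.prod_image hed.injOn, Finset.prod_congr rfl (fun v _ => hs v),
      Finset.prod_mul_distrib, map_prod]
  have hss : (∏ v, s v) * (∏ v, s v) = 1 := by
    rw [← Finset.prod_mul_distrib]; exact Finset.prod_eq_one fun v _ => hs2 v
  have hg : (∏ e ∈ prs (n + 1) \ τ, ℓ e) * ∏ v, (X v - yy K (par v))
      = C (∏ v, s v) * ((∏ i, X i) * vdm K n) := by
    rw [← hsplit, hτp]
    have : (C (∏ v, s v) * C (∏ v, s v) : MvPolynomial (Fin n) K) = 1 := by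
      rw [← C_mul, hss, C_1]
    linear_combination (-(∏ e ∈ prs (n + 1) \ τ, ℓ e) * ∏ v, (X v - yy K (par v))) * this
  have hnm := tree_not_mem par r hr _ _ (left_ne_zero_of_mul_eq_one hss) hg
  intro hmem
  apply hnm
  refine Ideal.mem_of_dvd _ ?_ hmem
  have hpre : ∀ α : MvPolynomial (Fin n) K, ∃ e, α ∈ T → e ∈ prs (n + 1) \ τ ∧ α = ℓ e := by
    intro α
    by_cases hα : α ∈ T
    · obtain ⟨i, j, hij, he⟩ := tildePhi_exists α (hT hα)
      refine ⟨(i, j), fun _ => ⟨?_, he⟩⟩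
      rw [Finset.mem_sdiff, mem_prs]
      refine ⟨hij, fun hmem => ?_⟩
      obtain ⟨v, _, hv⟩ := Finset.mem_image.1 hmem
      have h1 := hnot v
      apply h1
      have : α = ℓ (ed v) := by rw [hv, he]
      rw [this] at hα
      exact hα
    · exact ⟨(0, 0), fun h => absurd h hα⟩
  choose pre hpre using hpre
  have : ∏ α ∈ T, α = ∏ e ∈ T.image pre, ℓ e := by
    rw [Finset.prod_image]
    · exact Finset.prod_congr rfl fun α hα => (hpre α hα).2
    · intro a ha b hb hab
      rw [(hpre a ha).2, (hpre b hb).2, hab]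
  rw [this]
  apply Finset.prod_dvd_prod_of_subset
  intro e he
  obtain ⟨α, hα, rfl⟩ := Finset.mem_image.1 he
  exact (hpre α hα).1

lemma mem_of_not_span [CharZero K] (T : Finset (MvPolynomial (Fin n) K))
    (hspan : Submodule.span K (tildePhi K n \ ↑T) ≠
        Submodule.span K (Set.range (X : Fin n → MvPolynomial (Fin n) K))) :
    (∏ α ∈ T, α) ∈ coinvIdeal K n := by
  classical
  set U := Submodule.span K (tildePhi K n \ ↑T) with hU
  have hle : U ≤ Submodule.span K (Set.range (X : Fin n → MvPolynomial (Fin n) K)) := by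
    rw [hU, Submodule.span_le]
    rintro α ⟨⟨i, j, _, rfl⟩ | ⟨i, rfl⟩, _⟩
    · exact Submodule.sub_mem _ (Submodule.subset_span ⟨i, rfl⟩) (Submodule.subset_span ⟨j, rfl⟩)
    · exact Submodule.subset_span ⟨i, rfl⟩
  have hb : ∃ b : Fin n, (X b : MvPolynomial (Fin n) K) ∉ U := by
    by_contra! hcon
    apply hspan
    refine le_antisymm hle ?_
    rw [Submodule.span_le]
    rintro _ ⟨i, rfl⟩
    exact hcon i
  obtain ⟨b, hb⟩ := hb
  have hcut := cut_mem (K := K) (fun i => (X i : MvPolynomial (Fin n) K) ∈ U) b hb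
  refine Ideal.mem_of_dvd _ ?_ hcut
  let ℓ : Fin (n + 1) × Fin (n + 1) → MvPolynomial (Fin n) K := fun e => yy K e.1 - yy K e.2
  have heq : (∏ i ∈ Finset.univ.filter (fun i => ¬ (X i : MvPolynomial (Fin n) K) ∈ U), X i) *
      (∏ e ∈ (prs n).filter (fun e => ¬ ((X e.1 : MvPolynomial (Fin n) K) ∈ U ↔
        (X e.2 : MvPolynomial (Fin n) K) ∈ U)), (X e.1 - X e.2)) =
      ∏ e ∈ (prs (n + 1)).filter (fun e => ¬ (yy K e.1 ∈ U ↔ yy K e.2 ∈ U)), ℓ e := by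
    rw [Finset.prod_filter (s := prs (n + 1)), prod_prs_succ, Finset.prod_filter,
      Finset.prod_filter]
    simp [ℓ]
  rw [heq, ← Finset.prod_image (f := fun α => α) (g := ℓ)]
  · apply Finset.prod_dvd_prod_of_subset
    intro α hα
    obtain ⟨e, he, rfl⟩ := Finset.mem_image.1 hα
    rw [Finset.mem_filter, mem_prs] at he
    by_contra hnT
    have hmem : ℓ e ∈ U := Submodule.subset_span ⟨yy_mem_tildePhi _ _ he.1, hnT⟩
    apply he.2
    constructor
    · intro h
      have := U.sub_mem h hmem
      simpa [ℓ] using this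
    · intro h
      have := U.add_mem h hmem
      simpa [ℓ] using this
  · exact ell_injOn.mono (by intro e he; exact (Finset.mem_filter.1 he).1)

end Coinv

theorem statement3 (K : Type*) [Field K] [CharZero K] (n : ℕ) (hn : 0 < n)
    (T : Finset (MvPolynomial (Fin n) K)) (hT : ↑T ⊆ tildePhi K n) :
    (∏ α ∈ T, α) ∈ coinvIdeal K n ↔
      Submodule.span K (tildePhi K n \ ↑T) ≠
        Submodule.span K (Set.range (X : Fin n → MvPolynomial (Fin n) K)) := by
  exact ⟨fun h hspan => Coinv.not_mem_of_span T hT hspan h, Coinv.mem_of_not_span T⟩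
end
end

section
/- The image of the derivation module of the full augmented braid arrangement under 𝔦 equals the coinvariant ideal: 𝔦_{A_{Φ̃⁺}} = (S^{S_n}_+). Consequently, for every subarrangement A ⊆ A_{Φ̃⁺}, (S^{S_n}_+) ⊆ 𝔦_A, i.e., the Solomon–Terao algebra ST(A,𝔦) = S/𝔦_A is a quotient of the coinvariant ring S/(S^{S_n}_+). -/
open MvPolynomial

noncomputable section

/-- `varx K n i` is the variable `x_i` for `1 ≤ i ≤ n`, with the convention `x_0 = 0`. -/
def varx (K : Type*) [Field K] (n : ℕ) (i : Fin (n + 1)) : MvPolynomial (Fin n) K :=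
  if h : (i : ℕ) = 0 then 0 else X ⟨(i : ℕ) - 1, by have := i.isLt; omega⟩

/-- The linear form `α_{i,j}`: equal to `x_j` when `i = 0` and `x_i − x_j` when `i ≥ 1`. -/
def alp (K : Type*) [Field K] (n : ℕ) (i j : Fin (n + 1)) : MvPolynomial (Fin n) K :=
  if i = 0 then varx K n j else varx K n i - varx K n j

/-- Defining polynomial `Q(A)` of an arrangement encoded by its index pairs. -/
def QA (K : Type*) [Field K] (n : ℕ) (A : Finset (Fin (n + 1) × Fin (n + 1))) :
    MvPolynomial (Fin n) K :=
  ∏ p ∈ A, alp K n p.1 p.2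

/-- The module of derivations `θ` with `q ∣ θ(q)`; for `q = Q(A)` this is `Der(A)`. -/
def DerOf (K : Type*) [Field K] (n : ℕ) (q : MvPolynomial (Fin n) K) :
    Submodule (MvPolynomial (Fin n) K)
      (Derivation K (MvPolynomial (Fin n) K) (MvPolynomial (Fin n) K)) where
  carrier := {θ | q ∣ θ q}
  add_mem' := by
    intro a b ha hb
    simpa using dvd_add ha hb
  zero_mem' := by simp
  smul_mem' := by
    intro c θ hθ
    simpa [smul_eq_mul] using Dvd.dvd.mul_left hθ c

/-- The `S`-module map `𝔦 : Der(S) → S`, `θ ↦ Σ_k θ(x_k)`, i.e. `∂_k ↦ 1`. -/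
def iMap (K : Type*) [Field K] (n : ℕ) :
    Derivation K (MvPolynomial (Fin n) K) (MvPolynomial (Fin n) K)
      →ₗ[MvPolynomial (Fin n) K] MvPolynomial (Fin n) K where
  toFun θ := ∑ k : Fin n, θ (X k)
  map_add' := by intro a b; simp [Finset.sum_add_distrib]
  map_smul' := by intro c θ; simp [Finset.mul_sum]

/-- The Solomon–Terao ideal `𝔦_A = 𝔦(Der(A))`. -/
def iIdeal (K : Type*) [Field K] (n : ℕ) (A : Finset (Fin (n + 1) × Fin (n + 1))) :
    Ideal (MvPolynomial (Fin n) K) :=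
  Submodule.map (iMap K n) (DerOf K n (QA K n A))


/-- The full augmented braid arrangement `A_{Φ̃⁺} = {H_{i,j} : 0 ≤ i < j ≤ n}`. -/
def fullArr (n : ℕ) : Finset (Fin (n + 1) × Fin (n + 1)) :=
  Finset.univ.filter fun p : Fin (n + 1) × Fin (n + 1) => p.1 < p.2

lemma varx_zero (K : Type*) [Field K] (n : ℕ) : varx K n 0 = 0 := by simp [varx]

lemma varx_succ (K : Type*) [Field K] (n : ℕ) (k : Fin n) : varx K n k.succ = X k := by
  simp [varx]

/-- The normalized linear form. -/
def wform (K : Type*) [Field K] (n : ℕ) (i j : Fin (n + 1)) : MvPolynomial (Fin n) K :=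
  varx K n j - varx K n i

lemma alp_cases (K : Type*) [Field K] (n : ℕ) (i j : Fin (n + 1)) :
    alp K n i j = wform K n i j ∨ alp K n i j = - wform K n i j := by
  by_cases h : i = 0
  · left; subst h; simp [alp, wform, varx_zero]
  · right; simp [alp, wform, h]

lemma wform_irred (K : Type*) [Field K] (n : ℕ) (i j : Fin (n + 1)) (hij : i < j) :
    Irreducible (wform K n i j) := by
  obtain ⟨k, rfl⟩ := Fin.exists_succ_eq.2 (Fin.ne_zero_of_lt hij)
  have h := irreducible_mul_X_add (1 : MvPolynomial (Fin n) K) (-varx K n i) k one_ne_zero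
    (by simp) (by
      rw [vars_neg]
      refine Fin.cases ?_ (fun l => ?_) i (motive := fun i => i < k.succ → k ∉ (varx K n i).vars) hij
      · intro _; simp [varx_zero]
      · intro hl
        rw [varx_succ, vars_X]
        simp only [Finset.mem_singleton]
        rintro rfl
        exact lt_irrefl _ hl) isRelPrime_one_left
  simpa [wform, varx_succ, sub_eq_add_neg] using h

lemma eval_varx (K : Type*) [Field K] (n : ℕ) (y : Fin (n + 1) → K) (hy : y 0 = 0)
    (i : Fin (n + 1)) : eval (fun k : Fin n => y k.succ) (varx K n i) = y i := by
  refine Fin.cases ?_ (fun l => ?_) i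
  · simp [varx_zero, hy]
  · simp [varx_succ]

lemma wform_relPrime (K : Type*) [Field K] [CharZero K] (n : ℕ) (i j k l : Fin (n + 1))
    (hij : i < j) (hkl : k < l) (hne : ¬ (i = k ∧ j = l)) :
    IsRelPrime (wform K n i j) (wform K n k l) := by
  rw [(wform_irred K n i j hij).isRelPrime_iff_not_dvd]
  rintro ⟨c, hc⟩
  let y : Fin (n + 1) → K := fun m => if m = j then ((i : ℕ) : K) else ((m : ℕ) : K)
  have hj0 : j ≠ 0 := Fin.ne_zero_of_lt hij
  have hy : y 0 = 0 := by simp [y, hj0.symm]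
  have h := congrArg (eval (fun k : Fin n => y k.succ)) hc
  simp only [wform, map_sub, map_mul, eval_varx K n y hy] at h
  have e : y j - y i = 0 := by simp [y, hij.ne]
  rw [e, zero_mul, sub_eq_zero] at h
  simp only [y] at h
  split_ifs at h with h1 h2 h2
  · omega
  · have := Nat.cast_injective h; omega
  · have := Nat.cast_injective h; omega
  · have := Nat.cast_injective h; omega

lemma mem_fullArr (n : ℕ) (p : Fin (n + 1) × Fin (n + 1)) : p ∈ fullArr n ↔ p.1 < p.2 := by
  simp [fullArr]

lemma alp_assoc (K : Type*) [Field K] (n : ℕ) (i j : Fin (n + 1)) :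
    Associated (alp K n i j) (wform K n i j) := by
  rcases alp_cases K n i j with h | h <;> rw [h]
  exact (Associated.refl _).neg_left

lemma wform_dvd_of_mem (K : Type*) [Field K] [CharZero K] (n : ℕ)
    (θ : Derivation K (MvPolynomial (Fin n) K) (MvPolynomial (Fin n) K))
    (hθ : θ ∈ DerOf K n (QA K n (fullArr n))) (i j : Fin (n + 1)) (hij : i < j) :
    wform K n i j ∣ θ (wform K n i j) := by
  have hθ' : QA K n (fullArr n) ∣ θ (QA K n (fullArr n)) := hθ
  have hm : (i, j) ∈ fullArr n := (mem_fullArr n _).2 hij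
  have hQ : QA K n (fullArr n) =
      alp K n i j * ∏ p ∈ (fullArr n).erase (i, j), alp K n p.1 p.2 := by
    rw [QA]
    exact (Finset.mul_prod_erase (fullArr n)
      (fun p : Fin (n + 1) × Fin (n + 1) => alp K n p.1 p.2) hm).symm
  have hrel : IsRelPrime (wform K n i j)
      (∏ p ∈ (fullArr n).erase (i, j), alp K n p.1 p.2) := by
    refine IsRelPrime.prod_right fun p hp => ?_
    rw [Finset.mem_erase, mem_fullArr] at hp
    have := wform_relPrime K n i j p.1 p.2 hij hp.2
      (fun h => hp.1 (Prod.ext h.1.symm h.2.symm))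
    rcases alp_cases K n p.1 p.2 with h | h <;> rw [h]
    · exact this
    · exact this.neg_right
  have hd : wform K n i j ∣ alp K n i j := (alp_assoc K n i j).symm.dvd
  have h1 : wform K n i j ∣ θ (QA K n (fullArr n)) :=
    (hd.trans (by rw [hQ]; exact dvd_mul_right _ _)).trans hθ'
  rw [hQ, Derivation.leibniz, smul_eq_mul, smul_eq_mul,
    dvd_add_right (Dvd.dvd.mul_right hd _)] at h1
  have h2 := hrel.dvd_of_dvd_mul_left h1
  rcases alp_cases K n i j with h | h
  · rwa [h] at h2
  · rw [h, map_neg, dvd_neg] at h2; exact h2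

lemma interpolation (K : Type*) [Field K] [CharZero K] (n : ℕ)
    (f : Fin (n + 1) → MvPolynomial (Fin n) K)
    (hf : ∀ i j, i < j → wform K n i j ∣ f j - f i) :
    ∃ c : Fin (n + 1) → MvPolynomial (Fin n) K,
      ∀ i, ∑ k : Fin (n + 1), varx K n i ^ (k : ℕ) * c k = f i := by
  classical
  set V := Matrix.vandermonde (varx K n) with hV
  have hdet : V.det = ∏ p ∈ (Finset.univ : Finset (Fin (n + 1))).sigma Finset.Ioi,
      wform K n p.1 p.2 := by
    rw [hV, Matrix.det_vandermonde, Finset.prod_sigma]; rfl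
  have hdvd : ∀ k, V.det ∣ Matrix.cramer V f k := by
    intro k
    rw [hdet]
    refine Finset.prod_dvd_of_isRelPrime ?_ ?_
    · rintro ⟨i, j⟩ hp ⟨k, l⟩ hq hne
      simp at hp hq
      refine wform_relPrime K n i j k l hp hq ?_
      rintro ⟨rfl, rfl⟩
      exact hne rfl
    · rintro ⟨i, j⟩ hp
      have hij : i < j := by simpa using hp
      dsimp only
      rw [Matrix.cramer_apply, ← Ideal.mem_span_singleton, ← Ideal.Quotient.eq_zero_iff_mem,
        RingHom.map_det]
      refine Matrix.det_zero_of_row_eq hij.ne ?_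
      funext m
      simp only [RingHom.mapMatrix_apply, Matrix.map_apply, Matrix.updateCol_apply]
      have hv : Ideal.Quotient.mk (Ideal.span {wform K n i j}) (varx K n i) =
          Ideal.Quotient.mk (Ideal.span {wform K n i j}) (varx K n j) := by
        symm
        rw [Ideal.Quotient.eq, Ideal.mem_span_singleton]; exact dvd_rfl
      split_ifs
      · symm
        rw [Ideal.Quotient.eq, Ideal.mem_span_singleton]; exact hf i j hij
      · simp [hV, Matrix.vandermonde_apply, hv]
  have hne : V.det ≠ 0 := by
    rw [hdet, Finset.prod_ne_zero_iff]
    rintro ⟨i, j⟩ hp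
    exact (wform_irred K n i j (by simpa using hp)).ne_zero
  choose c hc using hdvd
  refine ⟨c, fun i => mul_left_cancel₀ hne ?_⟩
  have h := congrFun (Matrix.mulVec_cramer V f) i
  simp only [Pi.smul_apply, smul_eq_mul] at h
  rw [← h, Finset.mul_sum]
  simp only [Matrix.mulVec, dotProduct, hc]
  refine Finset.sum_congr rfl fun k _ => ?_
  rw [hV, Matrix.vandermonde_apply]; ring

lemma psum_mem_coinv (K : Type*) [Field K] (n : ℕ) (k : ℕ) (hk : k ≠ 0) :
    psum (Fin n) K k ∈ coinvIdeal K n := by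
  refine Ideal.subset_span ⟨psum_isSymmetric _ _ _, ?_⟩
  simp [psum, hk]

lemma coinv_le (K : Type*) [Field K] [CharZero K] (n : ℕ) (I : Ideal (MvPolynomial (Fin n) K))
    (hI : ∀ k : ℕ, k ≠ 0 → psum (Fin n) K k ∈ I) : coinvIdeal K n ≤ I := by
  have hes : ∀ k : ℕ, k ≠ 0 → esymm (Fin n) K k ∈ I := by
    intro k hk
    have h := mul_esymm_eq_sum (Fin n) K k
    have h1 : (k : MvPolynomial (Fin n) K) * esymm (Fin n) K k ∈ I := by
      rw [h]
      refine I.mul_mem_left _ (I.sum_mem fun a ha => I.mul_mem_left _ (hI _ ?_))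
      simp at ha
      omega
    have h2 := I.mul_mem_left (C ((k : K)⁻¹)) h1
    rw [← mul_assoc, ← map_natCast (C : K →+* MvPolynomial (Fin n) K), ← C_mul,
      inv_mul_cancel₀ (by exact_mod_cast hk), C_1, one_mul] at h2
    exact h2
  rw [coinvIdeal, Ideal.span_le]
  rintro f ⟨hs, h0⟩
  obtain ⟨q, hq⟩ := esymmAlgHom_surjective (σ := Fin n) (n := n) K (by simp) ⟨f, hs⟩
  have hq' : aeval (fun i : Fin n => esymm (Fin n) K (i + 1)) q = f := by
    rw [← esymmAlgHom_apply, hq]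
  have key : ∀ q : MvPolynomial (Fin n) K,
      aeval (fun i : Fin n => esymm (Fin n) K (i + 1)) q - C (constantCoeff q) ∈ I := by
    intro q
    induction q using MvPolynomial.induction_on with
    | C a => simp [algebraMap_eq]
    | add p q hp hq =>
      have := I.add_mem hp hq
      simp only [map_add]
      convert this using 1; ring
    | mul_X p i hp =>
      simp only [map_mul, aeval_X, constantCoeff_X, mul_zero, map_zero, sub_zero]
      exact I.mul_mem_left _ (hes _ (by simp))
  have key2 := key q
  rw [hq'] at key2
  have hc : constantCoeff q = 0 := by
    have hz : ∀ k : ℕ, k ≠ 0 → constantCoeff (esymm (Fin n) K k) = 0 := by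
      intro k hk
      rw [esymm, map_sum]
      refine Finset.sum_eq_zero fun t ht => ?_
      rw [map_prod]
      have : t.Nonempty := by
        rw [← Finset.card_pos]; rw [Finset.mem_powersetCard] at ht; omega
      obtain ⟨a, ha⟩ := this
      exact Finset.prod_eq_zero ha (by simp)
    have : ∀ q : MvPolynomial (Fin n) K, constantCoeff
        (aeval (fun i : Fin n => esymm (Fin n) K (i + 1)) q) = constantCoeff q := by
      intro q
      induction q using MvPolynomial.induction_on with
      | C a => simp [algebraMap_eq]
      | add p q hp hq => simp only [map_add, hp, hq]
      | mul_X p i hp => simp [hz]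
    rw [← this q, hq', h0]
  simpa [hc] using key2

/-- The derivation with `x_i` sent to `x_i ^ k`. -/
def powDer (K : Type*) [Field K] (n k : ℕ) :
    Derivation K (MvPolynomial (Fin n) K) (MvPolynomial (Fin n) K) :=
  mkDerivation K fun i => X i ^ k

lemma powDer_varx (K : Type*) [Field K] (n k : ℕ) (hk : k ≠ 0) (i : Fin (n + 1)) :
    powDer K n k (varx K n i) = varx K n i ^ k := by
  refine Fin.cases ?_ (fun l => ?_) i
  · simp [varx_zero, hk]
  · simp [varx_succ, powDer, mkDerivation_X]

lemma powDer_mem (K : Type*) [Field K] (n k : ℕ) (hk : k ≠ 0)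
    (A : Finset (Fin (n + 1) × Fin (n + 1))) : powDer K n k ∈ DerOf K n (QA K n A) := by
  classical
  have h1 : ∀ i j, alp K n i j ∣ powDer K n k (alp K n i j) := by
    intro i j
    have : wform K n i j ∣ powDer K n k (wform K n i j) := by
      rw [wform, map_sub, powDer_varx K n k hk, powDer_varx K n k hk]
      exact sub_dvd_pow_sub_pow _ _ _
    rcases alp_cases K n i j with h | h
    · rwa [h]
    · rw [h, map_neg, neg_dvd, dvd_neg]; exact this
  change QA K n A ∣ powDer K n k (QA K n A)
  induction A using Finset.induction_on with
  | empty => simp [QA]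
  | insert a s ha ih =>
    have e : QA K n (insert a s) = alp K n a.1 a.2 * QA K n s := Finset.prod_insert ha
    rw [e, Derivation.leibniz, smul_eq_mul, smul_eq_mul]
    refine dvd_add (mul_dvd_mul_left _ ih) ?_
    rw [mul_comm]
    exact mul_dvd_mul_left _ (h1 _ _)

theorem statement8 (K : Type*) [Field K] [CharZero K] (n : ℕ) (hn : 0 < n) :
    iIdeal K n (fullArr n) = coinvIdeal K n ∧
    ∀ A : Finset (Fin (n + 1) × Fin (n + 1)), A ⊆ fullArr n →
      coinvIdeal K n ≤ iIdeal K n A := by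
  have hle : ∀ A, coinvIdeal K n ≤ iIdeal K n A := by
    intro A
    refine coinv_le K n _ fun k hk => ⟨powDer K n k, powDer_mem K n k hk A, ?_⟩
    simp [iMap, powDer, mkDerivation_X, psum]
  refine ⟨le_antisymm ?_ (hle _), fun A _ => hle A⟩
  rintro _ ⟨θ, hθ, rfl⟩
  obtain ⟨c, hc⟩ := interpolation K n (fun i => θ (varx K n i)) (fun i j hij => by
    rw [← map_sub]; exact wform_dvd_of_mem K n θ hθ i j hij)
  have hc0 : c 0 = 0 := by
    have := hc 0
    simpa [varx_zero, Fin.sum_univ_succ] using this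
  have hsum : iMap K n θ = ∑ k : Fin n, c k.succ * psum (Fin n) K ((k : ℕ) + 1) := by
    have h1 : ∀ l : Fin n, θ (X l) = ∑ k : Fin n, X l ^ ((k : ℕ) + 1) * c k.succ := by
      intro l
      have := hc l.succ
      rw [Fin.sum_univ_succ, hc0, varx_succ] at this
      simpa using this.symm
    change ∑ l : Fin n, θ (X l) = _
    simp only [h1, psum, Finset.mul_sum]
    rw [Finset.sum_comm]
    refine Finset.sum_congr rfl fun k _ => Finset.sum_congr rfl fun l _ => mul_comm _ _
  rw [hsum]
  exact Ideal.sum_mem _ fun k _ => Ideal.mul_mem_left _ _ (psum_mem_coinv K n _ (by simp))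
end
end
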